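/- arXiv:1910.05058 — 2 statements merged into one kernel-verified Lean document; each statement's English description precedes it below -/
import Mathlib

section
/- Let G be a finite loopless graph (parallel edges allowed) with a spanning triangle-tree. Then G is not Z3-connected if and only if at least one of the following holds: (i) G is K3 or K4; (ii) G = K3 ⊕₂ G1 (a 2-sum of a triangle and G1), where G1 is not Z3-connected and contains a spanning triangle-tree; (iii) G is a bull-growing of a graph H that is not Z3-connected and contains a spanning triangle-tree. -/
open scoped Classical

/-- A finite loopless multigraph: finite vertex and edge types, each edge has an
unordered pair of distinct endpoints (parallel edges allowed, loops forbidden). -/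
structure Multigraph where
  V : Type
  E : Type
  fintypeV : Fintype V
  fintypeE : Fintype E
  ends : E → Sym2 V
  loopless : ∀ e, ¬ (ends e).IsDiag

attribute [instance] Multigraph.fintypeV Multigraph.fintypeE

namespace Multigraph

/-- `D` is an orientation of `G`: each edge is assigned an ordered pair (tail, head)
compatible with its endpoints. -/
def IsOrientation (G : Multigraph) (D : G.E → G.V × G.V) : Prop :=
  ∀ e, G.ends e = s((D e).1, (D e).2)

/-- Out-degree of `v` under the orientation `D` (tail = first component). -/
noncomputable def outDeg (G : Multigraph) (D : G.E → G.V × G.V) (v : G.V) : ℕ :=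
  {e : G.E | (D e).1 = v}.ncard

/-- In-degree of `v` under the orientation `D` (head = second component). -/
noncomputable def inDeg (G : Multigraph) (D : G.E → G.V × G.V) (v : G.V) : ℕ :=
  {e : G.E | (D e).2 = v}.ncard

/-- Flow conservation: at every vertex the sum of `f` over outgoing arcs equals the sum
over incoming arcs. -/
def IsConserving (G : Multigraph) (D : G.E → G.V × G.V) (f : G.E → ℤ) : Prop :=
  ∀ v : G.V,
    (∑ e : G.E, if (D e).1 = v then f e else 0) =
      ∑ e : G.E, if (D e).2 = v then f e else 0

/-- `G` has a nowhere-zero 3-flow. -/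
def HasNZ3Flow (G : Multigraph) : Prop :=
  ∃ (D : G.E → G.V × G.V) (f : G.E → ℤ),
    G.IsOrientation D ∧ (∀ e, 1 ≤ |f e| ∧ |f e| ≤ 2) ∧ G.IsConserving D f

/-- `G` is `Z3`-connected: every `Z3`-boundary is realized by some orientation. -/
def Z3Connected (G : Multigraph) : Prop :=
  ∀ β : G.V → ZMod 3, (∑ v : G.V, β v) = 0 →
    ∃ D : G.E → G.V × G.V, G.IsOrientation D ∧
      ∀ v : G.V, ((G.outDeg D v : ZMod 3) - (G.inDeg D v : ZMod 3)) = β v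

/-- Degree of a vertex: number of edges incident with it. -/
noncomputable def degree (G : Multigraph) (v : G.V) : ℕ :=
  {e : G.E | v ∈ G.ends e}.ncard

/-- `(S, F)` is a triangle-tree subgraph of `G`: start from a triangle and repeatedly
add a new vertex joined to the two endpoints of an existing edge. -/
inductive IsTriangleTree (G : Multigraph) : Set G.V → Set G.E → Prop
  | base (x y z : G.V) (e1 e2 e3 : G.E)
      (hxy : x ≠ y) (hxz : x ≠ z) (hyz : y ≠ z)
      (h1 : G.ends e1 = s(x, y)) (h2 : G.ends e2 = s(y, z)) (h3 : G.ends e3 = s(x, z)) :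
      IsTriangleTree G {x, y, z} {e1, e2, e3}
  | grow (S : Set G.V) (F : Set G.E) (hT : IsTriangleTree G S F)
      (v a b : G.V) (hv : v ∉ S) (e : G.E) (he : e ∈ F) (hab : G.ends e = s(a, b))
      (e1 e2 : G.E) (h1 : G.ends e1 = s(v, a)) (h2 : G.ends e2 = s(v, b)) :
      IsTriangleTree G (insert v S) (insert e1 (insert e2 F))

/-- `G` contains a spanning triangle-tree. -/
def HasSpanningTriangleTree (G : Multigraph) : Prop :=
  ∃ F : Set G.E, G.IsTriangleTree Set.univ F

/-- Degree of `v` inside the edge set `F`. -/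
noncomputable def degIn (G : Multigraph) (F : Set G.E) (v : G.V) : ℕ :=
  {e : G.E | e ∈ F ∧ v ∈ G.ends e}.ncard

/-- `(S, F)` is a triangle-path subgraph: a triangle-tree which is either a single
triangle or has exactly two leaves (vertices of degree 2). -/
def IsTrianglePath (G : Multigraph) (S : Set G.V) (F : Set G.E) : Prop :=
  G.IsTriangleTree S F ∧ (S.ncard = 3 ∨ {v ∈ S | G.degIn F v = 2}.ncard = 2)

/-- `(S, F)` is a subgraph of `G`: endpoints of every chosen edge are chosen vertices. -/
def Subgraph (G : Multigraph) (S : Set G.V) (F : Set G.E) : Prop :=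
  ∀ e ∈ F, ∀ v, v ∈ G.ends e → v ∈ S

/-- `G` is isomorphic to the complete (simple) graph on `n` vertices. -/
def IsCompleteGraphOn (G : Multigraph) (n : ℕ) : Prop :=
  ∃ (φ : G.V ≃ Fin n) (ψ : G.E ≃ {p : Sym2 (Fin n) // ¬ p.IsDiag}),
    ∀ e, Sym2.map (⇑φ) (G.ends e) = (ψ e).1

def IsK3 (G : Multigraph) : Prop := G.IsCompleteGraphOn 3

def IsK4 (G : Multigraph) : Prop := G.IsCompleteGraphOn 4

/-- `G` is a bull-growing of `H` (equivalently, `H` is the bull-reduction of `G`):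
`u, v` are adjacent vertices of degree 3 in `G` with common neighbour `w`, the remaining
neighbours of `u`, `v` are `a`, `b`, and `H = G - u - v + ab` (with a loop deleted when
`a = b`). -/
def IsBullGrowing (G H : Multigraph) : Prop :=
  ∃ (u v w a b : G.V) (euv euw evw eua evb : G.E),
    G.ends euv = s(u, v) ∧ G.ends euw = s(u, w) ∧ G.ends evw = s(v, w) ∧
    G.ends eua = s(u, a) ∧ G.ends evb = s(v, b) ∧
    a ≠ v ∧ b ≠ u ∧
    euv ≠ euw ∧ euv ≠ eua ∧ euw ≠ eua ∧
    euv ≠ evw ∧ euv ≠ evb ∧ evw ≠ evb ∧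
    {e : G.E | u ∈ G.ends e} = {euv, euw, eua} ∧
    {e : G.E | v ∈ G.ends e} = {euv, evw, evb} ∧
    ∃ φ : H.V → G.V, Function.Injective φ ∧
      Set.range φ = {x : G.V | x ≠ u ∧ x ≠ v} ∧
      ((a = b → ∃ ψ : H.E → G.E, Function.Injective ψ ∧
          Set.range ψ = {e : G.E | e ∉ ({euv, euw, evw, eua, evb} : Set G.E)} ∧
          ∀ e, G.ends (ψ e) = Sym2.map φ (H.ends e)) ∧
       (a ≠ b → ∃ (e0 : H.E) (ψ : H.E → G.E),
          Sym2.map φ (H.ends e0) = s(a, b) ∧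
          Set.InjOn ψ {e : H.E | e ≠ e0} ∧
          ψ '' {e : H.E | e ≠ e0} = {e : G.E | e ∉ ({euv, euw, evw, eua, evb} : Set G.E)} ∧
          ∀ e, e ≠ e0 → G.ends (ψ e) = Sym2.map φ (H.ends e)))

/-- `(S, F)` is a triangle (a `K3` subgraph) of `G`. -/
def IsTriangleSub (G : Multigraph) (S : Set G.V) (F : Set G.E) : Prop :=
  ∃ (x y z : G.V) (e1 e2 e3 : G.E),
    x ≠ y ∧ x ≠ z ∧ y ≠ z ∧
    G.ends e1 = s(x, y) ∧ G.ends e2 = s(y, z) ∧ G.ends e3 = s(x, z) ∧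
    S = {x, y, z} ∧ F = {e1, e2, e3}

/-- The subgraph `(S, F)` of `G` is `Z3`-connected (as a graph in its own right). -/
def SubZ3Connected (G : Multigraph) (S : Set G.V) (F : Set G.E) : Prop :=
  ∀ β : G.V → ZMod 3, (∀ v, v ∉ S → β v = 0) → (∑ v : G.V, β v) = 0 →
    ∃ D : G.E → G.V × G.V, G.IsOrientation D ∧
      ∀ v ∈ S, (({e : G.E | e ∈ F ∧ (D e).1 = v}.ncard : ZMod 3)
        - ({e : G.E | e ∈ F ∧ (D e).2 = v}.ncard : ZMod 3)) = β v

/-- `G` is the 2-sum of its subgraphs `(SA, FA)` and `(SB, FB)`: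
`E(G) = E(A) ∪ E(B)`, `|E(A) ∩ E(B)| = 1` and `|V(A) ∩ V(B)| = 2`. -/
def IsTwoSum (G : Multigraph) (SA : Set G.V) (FA : Set G.E)
    (SB : Set G.V) (FB : Set G.E) : Prop :=
  G.Subgraph SA FA ∧ G.Subgraph SB FB ∧
  FA ∪ FB = Set.univ ∧ (FA ∩ FB).ncard = 1 ∧ (SA ∩ SB).ncard = 2

/-- All vertices of `G` are joined by walks using only edges from `F`. -/
def ConnOn (G : Multigraph) (F : Set G.E) : Prop :=
  ∀ u v : G.V, Relation.ReflTransGen (fun x y => ∃ e ∈ F, G.ends e = s(x, y)) u v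

/-- The spanning subgraph with edge set `F` is 2-edge-connected:
connected and with no cut edge. -/
def TwoEdgeConnOn (G : Multigraph) (F : Set G.E) : Prop :=
  G.ConnOn F ∧ ∀ e ∈ F, G.ConnOn (F \ {e})

/-- The orientation `D` is strongly connected. -/
def StronglyConnected (G : Multigraph) (D : G.E → G.V × G.V) : Prop :=
  ∀ u v : G.V, Relation.ReflTransGen (fun x y => ∃ e : G.E, D e = (x, y)) u v

/-- `G` belongs to the class `S3`: every `Z3`-boundary is realized by a strongly
connected orientation. -/
def InS3 (G : Multigraph) : Prop :=
  ∀ β : G.V → ZMod 3, (∑ v : G.V, β v) = 0 →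
    ∃ D : G.E → G.V × G.V, G.IsOrientation D ∧ G.StronglyConnected D ∧
      ∀ v : G.V, ((G.outDeg D v : ZMod 3) - (G.inDeg D v : ZMod 3)) = β v

/-- `G` has a cycle (of length ≥ 2, so possibly a pair of parallel edges) all of whose
edges lie in `A`. -/
def HasCycleIn (G : Multigraph) (A : Set G.E) : Prop :=
  ∃ (vs : List G.V) (es : List G.E),
    2 ≤ vs.length ∧ vs.Nodup ∧ es.Nodup ∧ es.length = vs.length ∧
    (∀ e ∈ es, e ∈ A) ∧
    ∀ (i : ℕ) (h1 : i < es.length) (h2 : i < vs.length)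
      (h3 : (i + 1) % vs.length < vs.length),
      G.ends (es.get ⟨i, h1⟩) = s(vs.get ⟨i, h2⟩, vs.get ⟨(i + 1) % vs.length, h3⟩)

/-- `(vs, es)` is a path from `u` to `v` in `G`. -/
def IsPath (G : Multigraph) (u v : G.V) (vs : List G.V) (es : List G.E) : Prop :=
  vs.Nodup ∧ es.Nodup ∧ vs.head? = some u ∧ vs.getLast? = some v ∧
  vs.length = es.length + 1 ∧
  ∀ (i : ℕ) (h1 : i < es.length) (h2 : i < vs.length) (h3 : i + 1 < vs.length),
    G.ends (es.get ⟨i, h1⟩) = s(vs.get ⟨i, h2⟩, vs.get ⟨i + 1, h3⟩)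

/-- `H` is isomorphic to the subgraph `(S, F)` of `G`. -/
def IsIsoToSub (H G : Multigraph) (S : Set G.V) (F : Set G.E) : Prop :=
  ∃ (φ : H.V → G.V) (ψ : H.E → G.E),
    Function.Injective φ ∧ Set.range φ = S ∧
    Function.Injective ψ ∧ Set.range ψ = F ∧
    ∀ e, G.ends (ψ e) = Sym2.map φ (H.ends e)

/-- `G'` is (isomorphic to) the graph obtained from `G` by adding two new edges with
endpoint pairs `p` and `q`. -/
def IsAddTwoEdges (G : Multigraph) (p q : Sym2 G.V) (G' : Multigraph) : Prop :=
  ∃ (φ : G.V ≃ G'.V) (e1 e2 : G'.E), e1 ≠ e2 ∧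
    G'.ends e1 = Sym2.map (⇑φ) p ∧ G'.ends e2 = Sym2.map (⇑φ) q ∧
    ∃ ψ : G.E → G'.E, Function.Injective ψ ∧
      Set.range ψ = {e : G'.E | e ≠ e1 ∧ e ≠ e2} ∧
      ∀ e, G'.ends (ψ e) = Sym2.map (⇑φ) (G.ends e)

/-- `G'` is (isomorphic to) the graph obtained from `G` by deleting the edges in `X`
and adding one new edge with endpoint pair `p`. -/
def IsDeleteAddEdge (G : Multigraph) (X : Set G.E) (p : Sym2 G.V) (G' : Multigraph) : Prop :=
  ∃ (φ : G.V ≃ G'.V) (e0 : G'.E),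
    G'.ends e0 = Sym2.map (⇑φ) p ∧
    ∃ ψ : {e : G.E // e ∉ X} → G'.E, Function.Injective ψ ∧
      Set.range ψ = {e : G'.E | e ≠ e0} ∧
      ∀ e : {e : G.E // e ∉ X}, G'.ends (ψ e) = Sym2.map (⇑φ) (G.ends e.1)

/-- `G` is a crystal: a spanning triangle-path plus one extra edge joining its two
leaves. -/
def IsCrystal (G : Multigraph) : Prop :=
  ∃ (F : Set G.E) (u v : G.V) (e0 : G.E),
    G.IsTrianglePath Set.univ F ∧ u ≠ v ∧
    G.degIn F u = 2 ∧ G.degIn F v = 2 ∧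
    e0 ∉ F ∧ G.ends e0 = s(u, v) ∧ insert e0 F = Set.univ

/-- The subgraph with edge set `F` is triangularly connected: any two of its edges lie
on a common triangle-path inside it. -/
def TriangularlyConnectedOn (G : Multigraph) (F : Set G.E) : Prop :=
  ∀ e1 ∈ F, ∀ e2 ∈ F, ∃ (S : Set G.V) (F' : Set G.E),
    F' ⊆ F ∧ G.IsTrianglePath S F' ∧ e1 ∈ F' ∧ e2 ∈ F'

/-- `G` is triangularly connected. -/
def TriangularlyConnected (G : Multigraph) : Prop :=
  G.TriangularlyConnectedOn Set.univ

/-- `G` contains a spanning triangularly-connected subgraph. -/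
def HasSpanningTriangularlyConnected (G : Multigraph) : Prop :=
  ∃ F : Set G.E, G.TriangularlyConnectedOn F

/-- `G` admits a circular `t/s`-flow. -/
def HasCircularFlow (G : Multigraph) (t s : ℤ) : Prop :=
  ∃ (D : G.E → G.V × G.V) (f : G.E → ℤ),
    G.IsOrientation D ∧ (∀ e, s ≤ |f e| ∧ |f e| ≤ t - s) ∧ G.IsConserving D f

end Multigraph

/-- `G` can be obtained from `K4` by a (possibly empty) series of bull-growing
operations. -/
inductive FromK4ByBull : Multigraph → Prop
  | base (G : Multigraph) : G.IsK4 → FromK4ByBull G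
  | grow (G H : Multigraph) : FromK4ByBull H → G.IsBullGrowing H → FromK4ByBull G

namespace BG

set_option linter.unusedSectionVars false
set_option linter.unusedFintypeInType false

variable {V : Type} [Fintype V]

/-- boundary of one arc from `a` to `b` -/
noncomputable def d (a b : V) : V → ZMod 3 :=
  fun v => (if v = a then 1 else 0) - (if v = b then 1 else 0)

/-- some orientation of the multiset of edges `M` has boundary `β` -/
def Real (M : Multiset (Sym2 V)) (β : V → ZMod 3) : Prop :=
  ∃ D : Multiset (V × V), D.map (fun p => s(p.1, p.2)) = M ∧
    (D.map (fun p => d p.1 p.2)).sum = β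

def Conn (S : Set V) (M : Multiset (Sym2 V)) : Prop :=
  ∀ β : V → ZMod 3, (∀ v, v ∉ S → β v = 0) → ∑ v, β v = 0 → Real M β

def Ins (S : Set V) (M : Multiset (Sym2 V)) : Prop :=
  ∀ e ∈ M, ∀ v ∈ e, v ∈ S

def LL (M : Multiset (Sym2 V)) : Prop := ∀ e ∈ M, ¬ e.IsDiag

theorem d_swap (a b : V) : d b a = - d a b := by
  funext v; simp [d]

theorem d_self (a : V) : d a a = 0 := by
  funext v; simp [d]

theorem sum_d (a b : V) : ∑ v, d a b v = 0 := by
  simp [d, Finset.sum_sub_distrib]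

theorem real_zero (β : V → ZMod 3) : Real 0 β ↔ β = 0 := by
  unfold Real
  constructor
  · rintro ⟨D, h1, h2⟩
    rw [Multiset.map_eq_zero] at h1
    subst h1
    simpa using h2.symm
  · rintro rfl
    exact ⟨0, by simp, by simp⟩

theorem real_cons (a b : V) (M : Multiset (Sym2 V)) (β : V → ZMod 3) :
    Real (s(a,b) ::ₘ M) β ↔ ∃ ε : ZMod 3, (ε = 1 ∨ ε = -1) ∧ Real M (β - ε • d a b) := by
  unfold Real
  constructor
  · rintro ⟨D, h1, h2⟩
    rw [← Multiset.map_eq_cons] at h1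
    obtain ⟨p, hp, hpe, hD⟩ := h1
    have h3 : (p.1 = a ∧ p.2 = b) ∨ (p.1 = b ∧ p.2 = a) := by
      exact Sym2.eq_iff.1 hpe
    rw [← Multiset.cons_erase hp, Multiset.map_cons, Multiset.sum_cons] at h2
    rcases h3 with ⟨h, h'⟩ | ⟨h, h'⟩
    · refine ⟨1, Or.inl rfl, D.erase p, hD, ?_⟩
      rw [← h2, h, h']; simp
    · refine ⟨-1, Or.inr rfl, D.erase p, hD, ?_⟩
      rw [← h2, h, h', d_swap]; simp
  · rintro ⟨ε, h | h, D, h1, h2⟩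
    · refine ⟨(a,b) ::ₘ D, by simp [h1], ?_⟩
      rw [Multiset.map_cons, Multiset.sum_cons, h2, h]; simp
    · refine ⟨(b,a) ::ₘ D, by simp [h1], ?_⟩
      rw [Multiset.map_cons, Multiset.sum_cons, h2, h, d_swap]; simp

theorem Real.cons {a b : V} {M : Multiset (Sym2 V)} {β : V → ZMod 3} (ε : ZMod 3)
    (hε : ε ≠ 0) (h : Real M (β - ε • d a b)) : Real (s(a,b) ::ₘ M) β := by
  rw [real_cons]
  refine ⟨ε, ?_, h⟩
  revert hε; clear h; revert ε; decide

theorem real_supp {M : Multiset (Sym2 V)} : ∀ {β : V → ZMod 3} {x : V}, Real M β →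
    (∀ e ∈ M, x ∉ e) → β x = 0 := by
  induction M using Multiset.induction_on with
  | empty =>
    intro β x h _
    rw [real_zero] at h; simp [h]
  | cons e M ih =>
    intro β x h hx
    induction e with
    | h a b =>
    rw [real_cons] at h
    obtain ⟨ε, -, h⟩ := h
    have h1 := ih h (fun e he => hx e (Multiset.mem_cons_of_mem he))
    have h2 := hx _ (Multiset.mem_cons_self _ _)
    simp only [Sym2.mem_iff, not_or] at h2
    simpa [d, h2.1, h2.2] using h1

theorem conn_cons {S : Set V} {M : Multiset (Sym2 V)} {e : Sym2 V} (h : Conn S M)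
    (he : ∀ v ∈ e, v ∈ S) : Conn S (e ::ₘ M) := by
  induction e with
  | h a b =>
  intro β h1 h2
  refine Real.cons 1 (by decide) (h _ ?_ ?_)
  · intro v hv
    have ha : v ≠ a := by rintro rfl; exact hv (he _ (by simp))
    have hb : v ≠ b := by rintro rfl; exact hv (he _ (by simp))
    simp [d, ha, hb, h1 v hv]
  · simp [Finset.sum_sub_distrib, h2, sum_d]

theorem conn_add {S : Set V} {M N : Multiset (Sym2 V)} (h : Conn S M)
    (he : Ins S N) : Conn S (N + M) := by
  induction N using Multiset.induction_on with
  | empty => simpa using h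
  | cons e N ih =>
    rw [Multiset.cons_add]
    exact conn_cons (ih fun e he' => he e (Multiset.mem_cons_of_mem he')) (he e (by simp))

theorem conn_le {S : Set V} {M N : Multiset (Sym2 V)} (h : Conn S M) (hle : M ≤ N)
    (he : Ins S N) : Conn S N := by
  obtain ⟨K, rfl⟩ := Multiset.le_iff_exists_add.1 hle
  rw [add_comm]
  exact conn_add h fun e h' => he e (by simp [h'])

/-- 2-trees, starting from a single edge -/
inductive TT : Set V → Multiset (Sym2 V) → Prop
  | base (a b : V) (h : a ≠ b) : TT {a, b} {s(a, b)}
  | grow (S : Set V) (F : Multiset (Sym2 V)) (hT : TT S F) (v a b : V) (hv : v ∉ S)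
      (hab : s(a, b) ∈ F) : TT (insert v S) (s(v, a) ::ₘ s(v, b) ::ₘ F)

theorem TT.ins {S : Set V} {F : Multiset (Sym2 V)} (h : TT S F) : Ins S F := by
  induction h with
  | base a b h => intro e he v hv; simp at he; subst he; simpa using hv
  | grow S F hT v a b hv hab ih =>
    intro e he x hx
    have h1 := ih _ hab a (by simp)
    have h2 := ih _ hab b (by simp)
    simp only [Multiset.mem_cons] at he
    rcases he with rfl | rfl | he
    · simp at hx; rcases hx with rfl | rfl <;> simp [*]
    · simp at hx; rcases hx with rfl | rfl <;> simp [*]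
    · exact Set.mem_insert_of_mem _ (ih _ he _ hx)

theorem TT.ll {S : Set V} {F : Multiset (Sym2 V)} (h : TT S F) : LL F := by
  induction h with
  | base a b h => intro e he; simp at he; subst he; simpa using h
  | grow S F hT v a b hv hab ih =>
    intro e he
    have h1 := hT.ins _ hab a (by simp)
    have h2 := hT.ins _ hab b (by simp)
    simp only [Multiset.mem_cons] at he
    rcases he with rfl | rfl | he
    · simp; rintro rfl; exact hv h1
    · simp; rintro rfl; exact hv h2
    · exact ih _ he

theorem TT.nodup {S : Set V} {F : Multiset (Sym2 V)} (h : TT S F) : F.Nodup := by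
  induction h with
  | base a b h => simp
  | grow S F hT v a b hv hab ih =>
    have h1 := hT.ll _ hab
    have h2 : ∀ c, s(v,c) ∉ F := fun c hc => hv (hT.ins _ hc v (by simp))
    simp only [Multiset.nodup_cons, Multiset.mem_cons, h2, or_false, not_false_eq_true, ih,
      and_true]
    intro h3
    apply h1
    simp only [Sym2.eq_iff] at h3
    simp only [Sym2.mk_isDiag_iff]
    rcases h3 with ⟨-, h⟩ | ⟨h, h'⟩
    · exact h
    · rw [h', h]

/-- A doubled edge of a 2-tree makes everything connected. -/
theorem TT.collapse {S : Set V} {F : Multiset (Sym2 V)} (h : TT S F) :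
    ∀ f ∈ F, Conn S (f ::ₘ F) := by
  induction h with
  | base a b h =>
    intro f hf
    simp only [Multiset.mem_singleton] at hf
    subst hf
    intro β h1 h2
    have hs : β a + β b = 0 := by
      rw [← h2, ← Finset.sum_subset (Finset.subset_univ {a, b}), Finset.sum_pair h]
      intro x _ hx
      apply h1; simpa using hx
    have key : ∃ ε ε' : ZMod 3, ε ≠ 0 ∧ ε' ≠ 0 ∧ ε + ε' = β a := by
      generalize β a = t; revert t; decide
    obtain ⟨ε, ε', h3, h4, h5⟩ := key
    refine Real.cons ε h3 (Real.cons (M := 0) ε' h4 ((real_zero _).2 ?_))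
    funext v
    by_cases hva : v = a
    · subst hva; simp [d, h]; rw [← h5]; ring
    · by_cases hvb : v = b
      · subst hvb; simp [d, hva]; linear_combination hs + h5
      · simp [d, hva, hvb, h1 v (by simp [hva, hvb])]
  | grow S F hT v a b hv hab ih =>
    have ha := hT.ins _ hab a (by simp)
    have hb := hT.ins _ hab b (by simp)
    have hva : v ≠ a := by rintro rfl; exact hv ha
    have hvb : v ≠ b := by rintro rfl; exact hv hb
    have key1 : ∀ t : ZMod 3, ∃ ε ε' : ZMod 3, ε ≠ 0 ∧ ε' ≠ 0 ∧ ε + ε' = t := by decide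
    have key2 : ∀ a b : V, a ∈ S → b ∈ S → v ≠ a → v ≠ b → Conn S (s(a,b) ::ₘ F) →
        Conn (insert v S) (s(v,a) ::ₘ s(v,a) ::ₘ s(v,b) ::ₘ F) := by
      intro a b ha hb hva hvb h β h1 h2
      have h3 := h (β - β v • d v a) (by
        intro x hx
        by_cases hxv : x = v
        · subst hxv; simp [d, hva]
        · have hxa : x ≠ a := by rintro rfl; exact hx ha
          simp [d, hxv, hxa, h1 x (by simp [hxv, hx])]) (by
        simp [Finset.sum_sub_distrib, h2, ← Finset.mul_sum, sum_d])
      rw [real_cons] at h3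
      obtain ⟨ε, hε, h3⟩ := h3
      obtain ⟨ε1, ε2, e1, e2, e3⟩ := key1 (β v - ε)
      refine Real.cons ε1 e1 (Real.cons ε2 e2 (Real.cons ε ?_ ?_))
      · rcases hε with rfl | rfl <;> decide
      · convert h3 using 1
        funext x
        simp only [d, Pi.sub_apply, Pi.smul_apply, smul_eq_mul]
        linear_combination (-(if x = v then 1 else 0) + (if x = a then 1 else 0)) * e3
    intro f hf
    simp only [Multiset.mem_cons] at hf
    rcases hf with rfl | rfl | hf
    · exact key2 a b ha hb hva hvb (ih _ hab)
    · have := key2 b a hb ha hvb hva (by rw [Sym2.eq_swap]; exact ih _ hab)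
      rwa [Multiset.cons_swap s(v,b) s(v,a)] at this
    · intro β h1 h2
      obtain ⟨ε1, ε2, e1, e2, e3⟩ := key1 (β v)
      rw [Multiset.cons_swap f, Multiset.cons_swap f]
      refine Real.cons ε1 e1 (Real.cons ε2 e2 (ih f hf _ ?_ ?_))
      · intro x hx
        by_cases hxv : x = v
        · subst hxv; simp [d, hva, hvb, ← e3]
        · have hxa : x ≠ a := by rintro rfl; exact hx ha
          have hxb : x ≠ b := by rintro rfl; exact hx hb
          simp [d, hxv, hxa, hxb, h1 x (by simp [hxv, hx])]
      · simp [Finset.sum_sub_distrib, h2, ← Finset.mul_sum, sum_d]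


theorem supp_sub {S : Set V} {β : V → ZMod 3} {x a : V} (ε : ZMod 3)
    (h : ∀ v, v ∉ insert x S → β v = 0) (ha : a ∈ S) :
    ∀ v, v ∉ insert x S → (β - ε • d x a) v = 0 := by
  intro v hv
  have h1 := h v hv
  simp only [Set.mem_insert_iff, not_or] at hv
  have hva : v ≠ a := by rintro rfl; exact hv.2 ha
  simp [d, hva, hv.1, h1]

theorem sum_sub {β : V → ZMod 3} {x a : V} (ε : ZMod 3) (h : ∑ v, β v = 0) :
    ∑ v, (β - ε • d x a) v = 0 := by
  simp [Finset.sum_sub_distrib, h, ← Finset.mul_sum, sum_d]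

theorem real_lift {S : Set V} {M : Multiset (Sym2 V)} {x a b : V} {β : V → ZMod 3}
    (h : Conn S (s(a,b) ::ₘ M))
    (h1 : ∀ v, v ∉ insert x S → β v = 0) (h2 : ∑ v, β v = 0) (h3 : β x = 0) :
    Real (s(x,a) ::ₘ s(x,b) ::ₘ M) β := by
  have h4 := h β (by
    intro v hv
    by_cases hvx : v = x
    · rw [hvx, h3]
    · exact h1 v (by simp [hvx, hv])) h2
  rw [real_cons] at h4
  obtain ⟨ε, hε, h4⟩ := h4
  have hε0 : ε ≠ 0 := by rcases hε with rfl | rfl <;> decide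
  refine Real.cons (-ε) (by simpa using hε0) (Real.cons ε hε0 ?_)
  convert h4 using 1
  funext v
  simp only [d, Pi.sub_apply, Pi.smul_apply, smul_eq_mul]
  ring

theorem leafRule {S : Set V} {F M E : Multiset (Sym2 V)} {x a b : V} {β : V → ZMod 3}
    (hT : TT S F) (hx : x ∉ S) (hab : s(a,b) ∈ F) (hF : F ≤ M) (hM : Ins S M)
    (hE : ∀ e ∈ E, ∃ y ∈ S, e = s(x,y))
    (h1 : ∀ v, v ∉ insert x S → β v = 0) (h2 : ∑ v, β v = 0)
    (hR : ¬ Real (s(x,a) ::ₘ s(x,b) ::ₘ (E + M)) β) :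
    (E = 0 ∧ β x ≠ 0) ∨ (∃ y ∈ S, E = {s(x,y)} ∧ β x = 0) := by
  have ha := hT.ins _ hab a (by simp)
  have hb := hT.ins _ hab b (by simp)
  have hc : Conn S (s(a,b) ::ₘ M) := by
    refine conn_le (hT.collapse _ hab) (Multiset.cons_le_cons _ hF) ?_
    intro e he v hv
    rcases Multiset.mem_cons.1 he with rfl | he
    · simp at hv; rcases hv with rfl | rfl <;> assumption
    · exact hM _ he _ hv
  have hne : ∀ y ∈ S, x ≠ y := by rintro y hy rfl; exact hx hy
  induction E using Multiset.induction_on with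
  | empty =>
    left
    refine ⟨rfl, fun h3 => hR ?_⟩
    rw [zero_add]
    exact real_lift hc h1 h2 h3
  | cons e E _ =>
    right
    obtain ⟨y, hy, rfl⟩ := hE e (by simp)
    have hxy := hne y hy
    induction E using Multiset.induction_on with
    | empty =>
      refine ⟨y, hy, rfl, ?_⟩
      by_contra h3
      apply hR
      rw [Multiset.cons_add, zero_add, Multiset.cons_swap s(x,b), Multiset.cons_swap s(x,a)]
      refine Real.cons (β x) h3 (real_lift hc (supp_sub _ h1 hy) (sum_sub _ h2) ?_)
      simp [d, hxy]
    | cons e E _ =>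
      exfalso
      obtain ⟨z, hz, rfl⟩ := hE e (by simp)
      have hxz := hne z hz
      apply hR
      have hc' : Conn (insert x S) (s(x,y) ::ₘ s(x,z) ::ₘ s(x,a) ::ₘ s(x,b) ::ₘ M) := by
        intro β h1 h2
        have key : ∃ ε ε' : ZMod 3, ε ≠ 0 ∧ ε' ≠ 0 ∧ ε + ε' = β x := by
          generalize β x = t; revert t; decide
        obtain ⟨ε, ε', e1, e2, e3⟩ := key
        refine Real.cons ε e1 (Real.cons ε' e2 (real_lift hc
          (supp_sub _ (supp_sub _ h1 hy) hz) (sum_sub _ (sum_sub _ h2)) ?_))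
        simp [d, hxy, hxz, ← e3]
      have hc2 := conn_add (N := E) hc' (by
        intro e he v hv
        obtain ⟨w, hw, rfl⟩ := hE e (by simp [he])
        simp at hv; rcases hv with rfl | rfl <;> simp [hw])
      convert hc2 β h1 h2 using 1
      simp only [← Multiset.singleton_add]
      abel

/-- edges at `x` -/
noncomputable def at' (x : V) (M : Multiset (Sym2 V)) : Multiset (Sym2 V) :=
  M.filter (fun e => x ∈ e)

noncomputable def av (x : V) (M : Multiset (Sym2 V)) : Multiset (Sym2 V) :=
  M.filter (fun e => ¬ x ∈ e)

theorem at_add_av (x : V) (M : Multiset (Sym2 V)) : at' x M + av x M = M :=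
  Multiset.filter_add_not _ _

theorem double_real {S : Set V} {F M : Multiset (Sym2 V)} (hT : TT S F) (hM : Ins S M)
    {f : Sym2 V} (hf : f ∈ F) (hle : f ::ₘ F ≤ M) : Conn S M :=
  conn_le (hT.collapse f hf) hle hM

theorem leafDecomp {S : Set V} {F M : Multiset (Sym2 V)} {x a b : V}
    (hT : TT S F) (hx : x ∉ S) (hF : s(x,a) ::ₘ s(x,b) ::ₘ F ≤ M)
    (hM : Ins (insert x S) M) (hL : LL M) :
    F ≤ av x M ∧ Ins S (av x M) ∧ ∃ E, at' x M = {s(x,a), s(x,b)} + E ∧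
      M = s(x,a) ::ₘ s(x,b) ::ₘ (E + av x M) ∧ (∀ e ∈ E, ∃ y ∈ S, e = s(x,y)) := by
  have hFx : ∀ e ∈ F, ¬ x ∈ e := fun e he h => hx (hT.ins e he x h)
  have hav : F ≤ av x M := by
    have h3 : F.filter (fun e => ¬ x ∈ e) = F := Multiset.filter_eq_self.2 hFx
    rw [← h3]
    exact Multiset.filter_le_filter _ ((Multiset.le_cons_self _ _).trans
      ((Multiset.le_cons_self _ _).trans hF))
  have hins : Ins S (av x M) := by
    intro e he v hv
    simp only [av, Multiset.mem_filter] at he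
    rcases hM e he.1 v hv with rfl | h
    · exact absurd hv he.2
    · exact h
  refine ⟨hav, hins, ?_⟩
  have hat : {s(x,a), s(x,b)} ≤ at' x M := by
    have h3 : at' x (s(x,a) ::ₘ s(x,b) ::ₘ F) = {s(x,a), s(x,b)} := by
      have : F.filter (fun e => x ∈ e) = 0 := by
        rw [Multiset.filter_eq_nil]; exact hFx
      simp [at', this]
    rw [← h3]
    exact Multiset.filter_le_filter _ hF
  obtain ⟨E, hE⟩ := Multiset.le_iff_exists_add.1 hat
  have hMeq : M = s(x,a) ::ₘ s(x,b) ::ₘ (E + av x M) := by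
    conv_lhs => rw [← at_add_av x M, hE]
    simp only [← Multiset.singleton_add, Multiset.insert_eq_cons]
    abel
  have hEs : ∀ e ∈ E, ∃ y ∈ S, e = s(x,y) := by
    intro e he
    have h3 : e ∈ at' x M := by rw [hE]; simp [he]
    simp only [at', Multiset.mem_filter] at h3
    obtain ⟨y, rfl⟩ := Sym2.mem_iff_exists.1 h3.2
    rcases hM _ h3.1 y (by simp) with rfl | h
    · exact absurd (by simp) (hL _ h3.1)
    · exact ⟨y, h, rfl⟩
  exact ⟨E, hE, hMeq, hEs⟩

/-- leaf rule, packaged -/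
theorem leafRule' {S : Set V} {F M : Multiset (Sym2 V)} {x a b : V} {β : V → ZMod 3}
    (hT : TT S F) (hx : x ∉ S) (hab : s(a,b) ∈ F) (hF : s(x,a) ::ₘ s(x,b) ::ₘ F ≤ M)
    (hM : Ins (insert x S) M) (hL : LL M)
    (h1 : ∀ v, v ∉ insert x S → β v = 0) (h2 : ∑ v, β v = 0)
    (hR : ¬ Real M β) :
    F ≤ av x M ∧ Ins S (av x M) ∧
    ((at' x M = {s(x,a), s(x,b)} ∧ β x ≠ 0) ∨
     (∃ y ∈ S, y ≠ a ∧ y ≠ b ∧ at' x M = {s(x,a), s(x,b), s(x,y)} ∧ β x = 0)) := by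
  obtain ⟨hav, hins, E, hE, hMeq, hEs⟩ := leafDecomp hT hx hF hM hL
  refine ⟨hav, hins, ?_⟩
  have hT' := TT.grow S F hT x a b hx hab
  rcases leafRule (E := E) hT hx hab hav hins hEs h1 h2 (by rwa [← hMeq]) with ⟨h, h'⟩ | ⟨y, hy, h, h'⟩
  · left
    refine ⟨by rw [hE, h, add_zero], h'⟩
  · right
    have hd : ∀ c, s(x,c) ∈ s(x,a) ::ₘ s(x,b) ::ₘ F → y ≠ c := by
      rintro c hc rfl
      refine hR (double_real hT' hM hc ?_ β h1 h2)
      rw [hMeq, h]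
      have : s(x,y) ::ₘ s(x,a) ::ₘ s(x,b) ::ₘ F = s(x,a) ::ₘ s(x,b) ::ₘ ({s(x,y)} + F) := by
        simp only [← Multiset.singleton_add]; abel
      rw [this]
      exact Multiset.cons_le_cons _ (Multiset.cons_le_cons _ (add_le_add_right hav _))
    refine ⟨y, hy, hd a (by simp), hd b (by simp), ?_, h'⟩
    rw [hE, h]; rfl


noncomputable def starF (F : Multiset (Sym2 V)) (p : V) (c : V → V) (L : Finset V) :
    Multiset (Sym2 V) := F + ∑ x ∈ L, {s(x,p), s(x,c x)}

theorem starF_empty (F : Multiset (Sym2 V)) (p : V) (c : V → V) : starF F p c ∅ = F := by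
  simp [starF]

theorem starF_insert (F : Multiset (Sym2 V)) (p : V) (c : V → V) (L : Finset V) (x : V)
    (hx : x ∉ L) : starF F p c (insert x L) = s(x,p) ::ₘ s(x,c x) ::ₘ starF F p c L := by
  unfold starF
  rw [Finset.sum_insert hx]
  simp only [← Multiset.singleton_add, Multiset.insert_eq_cons]
  abel

theorem starF_congr (F : Multiset (Sym2 V)) (p : V) (c c' : V → V) (L : Finset V)
    (h : ∀ x ∈ L, c x = c' x) : starF F p c L = starF F p c' L := by
  unfold starF
  congr 1
  exact Finset.sum_congr rfl fun x hx => by rw [h x hx]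

theorem starF_erase (F : Multiset (Sym2 V)) (p : V) (c : V → V) (L : Finset V) (x : V)
    (hx : x ∈ L) : starF F p c L = s(x,p) ::ₘ s(x,c x) ::ₘ starF F p c (L.erase x) := by
  rw [← starF_insert _ _ _ _ _ (Finset.notMem_erase x L), Finset.insert_erase hx]

theorem mem_starF {F : Multiset (Sym2 V)} {p : V} {c : V → V} {L : Finset V} {e : Sym2 V} :
    e ∈ starF F p c L ↔ e ∈ F ∨ ∃ x ∈ L, e = s(x,p) ∨ e = s(x, c x) := by
  simp [starF, Multiset.mem_sum]

theorem TT.star {S : Set V} {F : Multiset (Sym2 V)} (hT : TT S F) {p : V} {c : V → V} :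
    ∀ (L : Finset V), (∀ x ∈ L, x ∉ S) → (∀ x ∈ L, s(p, c x) ∈ F) →
      TT (S ∪ ↑L) (starF F p c L) := by
  intro L
  induction L using Finset.induction_on with
  | empty => intro _ _; simpa [starF_empty] using hT
  | insert x L hx ih =>
    intro h1 h2
    rw [starF_insert _ _ _ _ _ hx, Finset.coe_insert, Set.union_insert]
    refine TT.grow _ _ (ih (fun y hy => h1 y (by simp [hy])) fun y hy => h2 y (by simp [hy]))
      _ _ _ ?_ ?_
    · have := h1 x (by simp)
      simp [this, hx]
    · exact mem_starF.2 (Or.inl (h2 x (by simp)))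

def Book (S : Set V) (F : Multiset (Sym2 V)) : Prop :=
  ∃ (p q : V) (L : Finset V), p ≠ q ∧ (∀ x ∈ L, x ∉ ({p, q} : Set V)) ∧ S = {p, q} ∪ ↑L ∧
    F = starF {s(p,q)} p (fun _ => q) L

def Fan (S : Set V) (F : Multiset (Sym2 V)) : Prop :=
  ∃ (S0 : Set V) (F0 : Multiset (Sym2 V)) (q r p : V) (c : V → V) (L : Finset V),
    TT S0 F0 ∧ s(q,r) ∈ F0 ∧ p ∉ S0 ∧ L.Nonempty ∧ (∀ x ∈ L, x ∉ insert p S0) ∧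
    (∀ x ∈ L, c x = q ∨ c x = r) ∧ S = insert p S0 ∪ ↑L ∧
    F = starF (s(p,q) ::ₘ s(p,r) ::ₘ F0) p c L

theorem fan_one {S0 : Set V} {F0 : Multiset (Sym2 V)} {q r p v e : V} (hT : TT S0 F0)
    (hqr : s(q,r) ∈ F0) (hp : p ∉ S0) (hv : v ∉ insert p S0) (he : e = q ∨ e = r) :
    Fan (insert v (insert p S0)) (s(v,p) ::ₘ s(v,e) ::ₘ s(p,q) ::ₘ s(p,r) ::ₘ F0) := by
  refine ⟨S0, F0, q, r, p, fun _ => e, {v}, hT, hqr, hp, by simp, by simpa using hv,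
    fun _ _ => he, by simp, ?_⟩
  have := starF_insert (s(p,q) ::ₘ s(p,r) ::ₘ F0) p (fun _ => e) ∅ v (by simp)
  rw [starF_empty] at this
  rw [← this]; rfl

theorem star_swap {S1 : Set V} {F1 : Multiset (Sym2 V)} {p : V} {c : V → V} {L : Finset V}
    (hT : TT S1 F1) (hL : ∀ x ∈ L, x ∉ S1) (hc : ∀ x ∈ L, s(p, c x) ∈ F1)
    {x v e : V} (hx : x ∈ L) (hv : v ∉ S1 ∪ ↑L) (he : e = p ∨ e = c x) :
    Fan (insert v (S1 ∪ ↑L)) (s(v,x) ::ₘ s(v,e) ::ₘ starF F1 p c L) := by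
  have hT' := hT.star (p := p) (c := c) (L.erase x) (fun y hy => hL y (Finset.mem_of_mem_erase hy))
    (fun y hy => hc y (Finset.mem_of_mem_erase hy))
  have hS : S1 ∪ (L : Set V) = insert x (S1 ∪ ↑(L.erase x)) := by
    rw [← Set.union_insert, ← Finset.coe_insert, Finset.insert_erase hx]
  rw [starF_erase _ _ _ _ _ hx, hS]
  rw [hS] at hv
  refine fan_one hT' (mem_starF.2 (Or.inl (hc x hx))) ?_ hv he
  simp [hL x hx]

theorem cons_swap2 {a b v : V} {F : Multiset (Sym2 V)} :
    s(v,a) ::ₘ s(v,b) ::ₘ F = s(v,b) ::ₘ s(v,a) ::ₘ F := Multiset.cons_swap _ _ _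

theorem TT.shape {S : Set V} {F : Multiset (Sym2 V)} (h : TT S F) : Book S F ∨ Fan S F := by
  induction h with
  | base a b h =>
    exact Or.inl ⟨a, b, ∅, h, by simp, by simp, by simp [starF_empty]⟩
  | grow S F hT v a b hv hab ih =>
    rcases ih with ⟨p, q, L, hpq, hL, rfl, rfl⟩ | ⟨S0, F0, q, r, p, c, L, hT0, hqr, hp, hne, hL, hc, rfl, rfl⟩
    · have hTb := TT.base p q hpq
      rcases mem_starF.1 hab with h | ⟨x, hx, h⟩
      · left
        have hvL : v ∉ L := fun h => hv (by simp [h])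
        refine ⟨p, q, insert v L, hpq, ?_, ?_, ?_⟩
        · intro x hx
          rcases Finset.mem_insert.1 hx with rfl | hx
          · exact fun h => hv (Or.inl h)
          · exact hL x hx
        · rw [Finset.coe_insert, Set.union_insert]
        · rw [starF_insert _ _ _ _ _ hvL]
          simp only [Multiset.mem_singleton, Sym2.eq_iff] at h
          rcases h with ⟨rfl, rfl⟩ | ⟨rfl, rfl⟩
          · rfl
          · exact cons_swap2
      · right
        have key := fun e (he : e = p ∨ e = q) => star_swap (c := fun _ => q) (p := p) hTb hL
          (by simp) hx hv (e := e) he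
        rcases h with h | h <;> rw [Sym2.eq_iff] at h <;> rcases h with ⟨rfl, rfl⟩ | ⟨rfl, rfl⟩
        · exact key _ (by simp)
        · rw [cons_swap2]; exact key _ (by simp)
        · exact key _ (by simp)
        · rw [cons_swap2]; exact key _ (by simp)
    · right
      have hT1 := TT.grow S0 F0 hT0 p q r hp hqr
      have hc1 : ∀ x ∈ L, s(p, c x) ∈ s(p,q) ::ₘ s(p,r) ::ₘ F0 := by
        intro x hx; rcases hc x hx with h | h <;> simp [h]
      have hvL : v ∉ L := fun h => hv (by simp [h])
      have hvp : v ≠ p := fun h => hv (by simp [h])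
      have hv0 : v ∉ S0 := fun h => hv (by simp [h])
      rcases mem_starF.1 hab with h | ⟨x, hx, h⟩
      · simp only [Multiset.mem_cons] at h
        have key : ∀ e, e = q ∨ e = r → Fan (insert v (insert p S0 ∪ ↑L))
            (s(v,p) ::ₘ s(v,e) ::ₘ starF (s(p,q) ::ₘ s(p,r) ::ₘ F0) p c L) := by
          intro e he
          refine ⟨S0, F0, q, r, p, fun x => if x = v then e else c x, insert v L, hT0, hqr, hp,
            by simp, ?_, ?_, ?_, ?_⟩
          · intro x hx
            rcases Finset.mem_insert.1 hx with rfl | hx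
            · exact fun h => hv (Or.inl h)
            · exact hL x hx
          · intro x hx
            rcases Finset.mem_insert.1 hx with rfl | hx
            · simpa using he
            · have : x ≠ v := by rintro rfl; contradiction
              simpa [this] using hc x hx
          · rw [Finset.coe_insert, Set.union_insert]
          · rw [starF_insert _ _ _ _ _ hvL]
            simp only [if_true]
            congr 2
            refine starF_congr _ _ _ _ _ fun x hx => ?_
            have : x ≠ v := by rintro rfl; exact hvL hx
            simp [this]
        rcases h with h | h | h
        · rw [Sym2.eq_iff] at h; rcases h with ⟨rfl, rfl⟩ | ⟨rfl, rfl⟩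
          · exact key _ (by simp)
          · rw [cons_swap2]; exact key _ (by simp)
        · rw [Sym2.eq_iff] at h; rcases h with ⟨rfl, rfl⟩ | ⟨rfl, rfl⟩
          · exact key _ (by simp)
          · rw [cons_swap2]; exact key _ (by simp)
        · refine ⟨insert v S0, s(v,a) ::ₘ s(v,b) ::ₘ F0, q, r, p, c, L,
            TT.grow _ _ hT0 _ _ _ hv0 h, by simp [hqr], ?_, hne, ?_, hc, ?_, ?_⟩
          · simp [hp, Ne.symm hvp]
          · intro x hx
            have h1 := hL x hx
            have : x ≠ v := by rintro rfl; exact hvL hx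
            simp only [Set.mem_insert_iff, not_or] at h1 ⊢
            exact ⟨h1.1, this, h1.2⟩
          · simp only [Set.insert_union]
            exact Set.insert_comm _ _ _
          · unfold starF
            simp only [← Multiset.singleton_add]
            abel
      · have key := fun e (he : e = p ∨ e = c x) => star_swap hT1 hL hc1 hx hv (e := e) he
        rcases h with h | h <;> rw [Sym2.eq_iff] at h <;> rcases h with ⟨rfl, rfl⟩ | ⟨rfl, rfl⟩
        · exact key _ (by simp)
        · rw [cons_swap2]; exact key _ (by simp)
        · exact key _ (by simp)
        · rw [cons_swap2]; exact key _ (by simp)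


theorem not_real_tri {x a b c : V} {M : Multiset (Sym2 V)} {β : V → ZMod 3}
    (h : ¬ Real ({s(x,a), s(x,b), s(x,c)} + M) β) (ε : ZMod 3) (hε : ε ≠ 0) :
    ¬ Real M (β - ε • (d x a + d x b + d x c)) := by
  intro h1
  apply h
  have : ({s(x,a), s(x,b), s(x,c)} + M : Multiset (Sym2 V)) =
    s(x,a) ::ₘ s(x,b) ::ₘ s(x,c) ::ₘ M := by
      simp only [← Multiset.singleton_add, Multiset.insert_eq_cons]
      abel
  rw [this]
  refine Real.cons ε hε (Real.cons ε hε (Real.cons ε hε ?_))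
  convert h1 using 1
  simp only [smul_add]
  abel

theorem fanK {S0 : Set V} {F0 M0 Ep : Multiset (Sym2 V)} {p q r : V} {c y : V → V}
    (hT : TT S0 F0) (hp : p ∉ S0) (hqr : s(q,r) ∈ F0) (hF : F0 ≤ M0) (hM : Ins S0 M0)
    (hE : ∀ e ∈ Ep, ∃ y ∈ S0, e = s(p,y)) : ∀ (L : Finset V),
    (∀ x ∈ L, x ∉ insert p S0) → (∀ x ∈ L, c x ∈ S0 ∧ y x ∈ S0) →
    ∀ β : V → ZMod 3, (∀ v, v ∉ insert p S0 → β v = 0) → ∑ v, β v = 0 →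
    ¬ Real ((∑ x ∈ L, {s(x,p), s(x,c x), s(x,y x)}) + (s(p,q) ::ₘ s(p,r) ::ₘ (Ep + M0))) β →
    L = ∅ ∨ ∃ x, L = {x} ∧ β p = 0 ∧ Ep = 0 := by
  intro L
  induction L using Finset.induction_on with
  | empty => intros; left; rfl
  | insert x L hx ih =>
    intro hL hcy β h1 h2 hR
    right
    rw [Finset.sum_insert hx, add_assoc] at hR
    have hxS := hL x (by simp)
    obtain ⟨hcx, hyx⟩ := hcy x (by simp)
    simp only [Set.mem_insert_iff, not_or] at hxS
    have hpc : p ≠ c x := by rintro h; rw [← h] at hcx; exact hp hcx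
    have hpy : p ≠ y x := by rintro h; rw [← h] at hyx; exact hp hyx
    have hxc : x ≠ c x := by rintro h; rw [← h] at hcx; exact hxS.2 hcx
    have hxy : x ≠ y x := by rintro h; rw [← h] at hyx; exact hxS.2 hyx
    have a1 : ∀ ε : ZMod 3, ∀ v, v ∉ insert p S0 →
        (β - ε • (d x p + d x (c x) + d x (y x))) v = 0 := by
      intro ε v hv
      have hb := h1 v hv
      simp only [Set.mem_insert_iff, not_or] at hv
      have hvc : v ≠ c x := by rintro rfl; exact hv.2 hcx
      have hvy : v ≠ y x := by rintro rfl; exact hv.2 hyx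
      by_cases hvx : v = x
      · subst hvx
        simp [d, hb, hv.1, hxc, hxy]
        clear * -
        revert ε; decide
      · simp [d, hb, hv.1, hvc, hvy, hvx]
    have a2 : ∀ ε : ZMod 3, ∑ v, (β - ε • (d x p + d x (c x) + d x (y x))) v = 0 := by
      intro ε
      simp [Finset.sum_sub_distrib, h2, ← Finset.mul_sum, Finset.sum_add_distrib, sum_d]
    have a3 : ∀ ε : ZMod 3, (β - ε • (d x p + d x (c x) + d x (y x))) p = β p + ε := by
      intro ε
      simp [d, Ne.symm hxS.1, hpc, hpy]
    have hn := not_real_tri hR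
    have ihε := fun (ε : ZMod 3) (hε : ε ≠ 0) => ih (fun z hz => hL z (by simp [hz]))
      (fun z hz => hcy z (by simp [hz])) _ (a1 ε) (a2 ε) (hn ε hε)
    have i1 := ihε 1 (by decide)
    have i2 := ihε (-1) (by decide)
    rw [a3] at i1 i2
    by_cases hLe : L = ∅
    · subst hLe
      refine ⟨x, by simp, ?_⟩
      have lr := fun (ε : ZMod 3) (hε : ε ≠ 0) => leafRule hT hp hqr hF hM hE (a1 ε) (a2 ε)
        (by simpa using hn ε hε)
      have l1 := lr 1 (by decide)
      have l2 := lr (-1) (by decide)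
      rw [a3] at l1 l2
      clear i1 i2 ihε lr
      rcases l1 with ⟨hE0, l1⟩ | ⟨z, hz, hE0, l1⟩
      · rcases l2 with ⟨-, l2⟩ | ⟨z, hz, h, -⟩
        · refine ⟨?_, hE0⟩
          revert l1 l2; generalize β p = t; revert t; decide
        · rw [hE0] at h; simp at h
      · exfalso
        rcases l2 with ⟨h, -⟩ | ⟨z, hz, h, l2⟩
        · rw [hE0] at h; simp at h
        · revert l1 l2; generalize β p = t; revert t; decide
    · exfalso
      rcases i1 with i1 | ⟨_, _, i1, _⟩
      · exact hLe i1
      rcases i2 with i2 | ⟨_, _, i2, _⟩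
      · exact hLe i2
      revert i1 i2; generalize β p = t; revert t; decide

theorem decompL (M : Multiset (Sym2 V)) : ∀ L : Finset V,
    (∀ e ∈ M, ∀ x ∈ L, ∀ x' ∈ L, x ∈ e → x' ∈ e → x = x') →
    ∑ x ∈ L, at' x M + M.filter (fun e => ∀ x ∈ L, x ∉ e) = M := by
  intro L
  induction L using Finset.induction_on with
  | empty => intro _; simp
  | insert x L hx ih =>
    intro h
    rw [Finset.sum_insert hx]
    have ih' := ih fun e he a ha b hb => h e he a (by simp [ha]) b (by simp [hb])
    conv_rhs => rw [← ih', ← Multiset.filter_add_not (fun e => x ∈ e)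
      (M.filter (fun e => ∀ x ∈ L, x ∉ e))]
    rw [Multiset.filter_filter, Multiset.filter_filter]
    have e1 : M.filter (fun e => x ∈ e ∧ ∀ x ∈ L, x ∉ e) = at' x M := by
      refine Multiset.filter_congr fun e he => ?_
      constructor
      · exact fun h => h.1
      · intro hxe
        refine ⟨hxe, fun z hz hze => ?_⟩
        have := h e he x (by simp) z (by simp [hz]) hxe hze
        subst this; exact hx hz
    have e2 : M.filter (fun e => ¬ x ∈ e ∧ ∀ x ∈ L, x ∉ e) =
        M.filter (fun e => ∀ z ∈ insert x L, z ∉ e) := by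
      refine Multiset.filter_congr fun e he => ?_
      simp
    rw [e1, e2]
    abel

theorem real_bull {u v w a b : V} {M : Multiset (Sym2 V)} {β : V → ZMod 3}
    (h : Real (s(a,b) ::ₘ M) β) :
    Real (s(u,v) ::ₘ s(u,w) ::ₘ s(v,w) ::ₘ s(u,a) ::ₘ s(v,b) ::ₘ M) β := by
  rw [real_cons] at h
  obtain ⟨ε, hε, h⟩ := h
  have hε0 : ε ≠ 0 := by rcases hε with rfl | rfl <;> decide
  have hε1 : -ε ≠ 0 := by simpa using hε0
  refine Real.cons (-ε) hε1 (Real.cons (-ε) hε1 (Real.cons ε hε0 (Real.cons (-ε) hε1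
    (Real.cons ε hε0 ?_))))
  convert h using 1
  funext x
  simp only [d, Pi.sub_apply, Pi.smul_apply, smul_eq_mul]
  have h3 : (3 : ZMod 3) = 0 := by decide
  linear_combination ε * ((if x = u then 1 else 0) - (if x = v then 1 else 0)) * h3

def Out2 (M : Multiset (Sym2 V)) : Prop :=
  ∃ (x a b : V) (S0 : Set V) (F0 M0 : Multiset (Sym2 V)),
    M = s(x,a) ::ₘ s(x,b) ::ₘ M0 ∧ TT S0 F0 ∧ x ∉ S0 ∧ insert x S0 = Set.univ ∧
    s(a,b) ∈ F0 ∧ F0 ≤ M0 ∧ Ins S0 M0 ∧ ¬ Conn S0 M0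

def Out3 (M : Multiset (Sym2 V)) : Prop :=
  ∃ (u v w a b : V) (S0 : Set V) (F0 M0 : Multiset (Sym2 V)),
    M = s(u,v) ::ₘ s(u,w) ::ₘ s(v,w) ::ₘ s(u,a) ::ₘ s(v,b) ::ₘ M0 ∧ u ≠ v ∧ u ∉ S0 ∧ v ∉ S0 ∧
    insert u (insert v S0) = Set.univ ∧ TT S0 F0 ∧ F0 ≤ M0 ∧ Ins S0 M0 ∧ s(w,b) ∈ F0 ∧
    a ∈ S0 ∧ a ≠ w ∧ ¬ Conn S0 (s(a,b) ::ₘ M0)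

theorem leaf_or {S : Set V} {F M : Multiset (Sym2 V)} {x a b : V} {β : V → ZMod 3}
    (hT : TT S F) (hx : x ∉ S) (hab : s(a,b) ∈ F) (hF : s(x,a) ::ₘ s(x,b) ::ₘ F ≤ M)
    (hS : insert x S = Set.univ) (hL : LL M) (h2 : ∑ v, β v = 0)
    (hR : ¬ Real M β) : Out2 M ∨ (∃ y ∈ S, y ≠ a ∧ y ≠ b ∧
      at' x M = {s(x,a), s(x,b), s(x,y)} ∧ β x = 0) := by
  have hM : Ins (insert x S) M := by intro e _ v _; rw [hS]; trivial
  have h1 : ∀ v, v ∉ insert x S → β v = 0 := by intro v hv; rw [hS] at hv; simp at hv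
  have ha := hT.ins _ hab a (by simp)
  have hb := hT.ins _ hab b (by simp)
  obtain ⟨hav, hins, ⟨h, h'⟩ | h⟩ := leafRule' hT hx hab hF hM hL h1 h2 hR
  · left
    have hMe : M = s(x,a) ::ₘ s(x,b) ::ₘ av x M := by
      conv_lhs => rw [← at_add_av x M, h]
      simp only [← Multiset.singleton_add, Multiset.insert_eq_cons]
      abel
    refine ⟨x, a, b, S, F, av x M, hMe, hT, hx, hS, hab, hav, hins, fun hc => hR ?_⟩
    rw [hMe]
    have key : ∃ ε ε' : ZMod 3, ε ≠ 0 ∧ ε' ≠ 0 ∧ ε + ε' = β x := by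
      generalize β x = t; revert t; decide
    obtain ⟨ε, ε', e1, e2, e3⟩ := key
    refine Real.cons ε e1 (Real.cons ε' e2 (hc _ ?_ (sum_sub _ (sum_sub _ h2))))
    intro v hv
    have hxa : x ≠ a := by rintro rfl; exact hx ha
    have hxb : x ≠ b := by rintro rfl; exact hx hb
    by_cases hvx : v = x
    · subst hvx; simp [d, hxa, hxb, ← e3]
    · exact supp_sub _ (supp_sub _ h1 ha) hb v (by simp [hvx, hv])
  · exact Or.inr h


theorem star_leaf {S1 : Set V} {F1 M : Multiset (Sym2 V)} {p : V} {c : V → V} {L : Finset V}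
    {β : V → ZMod 3} (hT : TT S1 F1) (hL : ∀ x ∈ L, x ∉ S1) (hc : ∀ x ∈ L, s(p, c x) ∈ F1)
    (hF : starF F1 p c L ≤ M) (hS : S1 ∪ ↑L = Set.univ) (hLL : LL M) (h2 : ∑ v, β v = 0)
    (hR : ¬ Real M β) {x : V} (hx : x ∈ L) :
    Out2 M ∨ (∃ y, y ≠ x ∧ y ≠ p ∧ y ≠ c x ∧
      at' x M = {s(x,p), s(x,c x), s(x,y)} ∧ β x = 0) := by
  have hT' := hT.star (p := p) (c := c) (L.erase x) (fun y hy => hL y (Finset.mem_of_mem_erase hy))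
    (fun y hy => hc y (Finset.mem_of_mem_erase hy))
  have hS' : S1 ∪ (L : Set V) = insert x (S1 ∪ ↑(L.erase x)) := by
    rw [← Set.union_insert, ← Finset.coe_insert, Finset.insert_erase hx]
  rw [starF_erase _ _ _ _ _ hx] at hF
  have hx' : x ∉ S1 ∪ (↑(L.erase x) : Set V) := by simp [hL x hx]
  rcases leaf_or hT' hx' (mem_starF.2 (Or.inl (hc x hx))) hF (by rw [← hS', hS]) hLL h2 hR with
    h | ⟨y, hy, h⟩
  · exact Or.inl h
  · refine Or.inr ⟨y, ?_, h⟩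
    rintro rfl; exact hx' hy

theorem star_pair {S1 : Set V} {F1 M : Multiset (Sym2 V)} {p : V} {c : V → V} {L : Finset V}
    {β : V → ZMod 3} (hT : TT S1 F1) (hL : ∀ x ∈ L, x ∉ S1) (hc : ∀ x ∈ L, s(p, c x) ∈ F1)
    (hF : starF F1 p c L ≤ M) (hS : S1 ∪ ↑L = Set.univ) (h2 : ∑ v, β v = 0)
    (hR : ¬ Real M β) {x x' y' : V} (hx : x ∈ L) (hx' : x' ∈ L) (hne : x' ≠ x)
    (hat : at' x M = {s(x,p), s(x,c x), s(x,x')}) (hβ : β x = 0)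
    (hat' : at' x' M = {s(x',p), s(x',c x'), s(x',y')}) (hβ' : β x' = 0) :
    Out3 M := by
  have hcS : ∀ z ∈ L, p ∈ S1 ∧ c z ∈ S1 := fun z hz =>
    ⟨hT.ins _ (hc z hz) _ (by simp), hT.ins _ (hc z hz) _ (by simp)⟩
  have n1 : ∀ z ∈ L, ∀ t ∈ S1, z ≠ t := by rintro z hz t ht rfl; exact hL z hz ht
  obtain ⟨hpS, hcx⟩ := hcS x hx
  obtain ⟨-, hcx'⟩ := hcS x' hx'
  have hy' : y' = x := by
    have h3 : s(x,x') ∈ at' x' M := by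
      have : s(x,x') ∈ at' x M := by rw [hat]; simp
      simp only [at', Multiset.mem_filter] at this ⊢
      exact ⟨this.1, by simp⟩
    rw [hat'] at h3
    simp only [Multiset.insert_eq_cons, Multiset.mem_cons, Multiset.mem_singleton, Sym2.eq_iff] at h3
    have a1 := n1 x hx _ hpS
    have a2 := n1 x hx _ hcx'
    rcases h3 with (⟨h, -⟩ | ⟨h, -⟩) | (⟨h, -⟩ | ⟨h, -⟩) | (⟨h, -⟩ | ⟨h, -⟩)
    · exact absurd h.symm hne
    · exact absurd h a1
    · exact absurd h.symm hne
    · exact absurd h a2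
    · exact absurd h.symm hne
    · exact h.symm
  subst hy'
  rename' y' => x
  set L' := (L.erase x).erase x' with hL'
  have hx'e : x' ∈ L.erase x := Finset.mem_erase.2 ⟨hne, hx'⟩
  have hsub : ∀ z ∈ L', z ∈ L := fun z hz => Finset.mem_of_mem_erase (Finset.mem_of_mem_erase hz)
  have hT' := hT.star (p := p) (c := c) L' (fun y hy => hL y (hsub y hy))
    (fun y hy => hc y (hsub y hy))
  have hSeq : insert x (insert x' (S1 ∪ (L' : Set V))) = Set.univ := by
    rw [← Set.union_insert, ← Set.union_insert, ← Finset.coe_insert, ← Finset.coe_insert,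
      Finset.insert_erase hx'e, Finset.insert_erase hx, hS]
  have hxn : x ∉ S1 ∪ (L' : Set V) := by simp [hL x hx, hL']
  have hxn' : x' ∉ S1 ∪ (L' : Set V) := by simp [hL x' hx', hL']
  have hF' : starF F1 p c L' ≤ M := by
    refine le_trans ?_ hF
    rw [starF_erase _ _ _ _ _ hx, starF_erase _ _ _ _ _ hx'e]
    exact (Multiset.le_cons_self _ _).trans ((Multiset.le_cons_self _ _).trans
      ((Multiset.le_cons_self _ _).trans (Multiset.le_cons_self _ _)))
  have hmid : at' x' (av x M) = {s(x',p), s(x',c x')} := by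
    have : at' x' (av x M) = av x (at' x' M) := by
      unfold at' av; rw [Multiset.filter_comm]
    rw [this, hat']
    have a1 := n1 x hx _ hpS
    have a2 := n1 x hx _ hcx'
    simp [av, hne.symm, a1, a2, Multiset.filter_singleton]
  have hMe : M = s(x,x') ::ₘ s(x,p) ::ₘ s(x',p) ::ₘ s(x,c x) ::ₘ s(x',c x') ::ₘ
      av x' (av x M) := by
    conv_lhs => rw [← at_add_av x M, hat, ← at_add_av x' (av x M), hmid]
    simp only [← Multiset.singleton_add, Multiset.insert_eq_cons]
    abel
  refine ⟨x, x', p, c x, c x', S1 ∪ (L' : Set V), starF F1 p c L', av x' (av x M), hMe, hne.symm,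
    hxn, hxn', hSeq, hT', ?_, ?_, mem_starF.2 (Or.inl (hc x' hx')), Or.inl hcx, ?_, ?_⟩
  · have e1 : starF F1 p c L' = av x' (av x (starF F1 p c L')) := by
      have b1 : av x (starF F1 p c L') = starF F1 p c L' :=
        Multiset.filter_eq_self.2 fun e he h => hxn (hT'.ins e he x h)
      have b2 : av x' (starF F1 p c L') = starF F1 p c L' :=
        Multiset.filter_eq_self.2 fun e he h => hxn' (hT'.ins e he x' h)
      rw [b1, b2]
    rw [e1]
    exact Multiset.filter_le_filter _ (Multiset.filter_le_filter _ hF')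
  · intro e he v hv
    simp only [av, Multiset.mem_filter] at he
    have : v ∈ insert x (insert x' (S1 ∪ (L' : Set V))) := by rw [hSeq]; trivial
    rcases this with rfl | rfl | h
    · exact absurd hv he.1.2
    · exact absurd hv he.2
    · exact h
  · intro h
    have := hT.ll _ (hc x hx)
    simp [h] at this
  · intro hcon
    apply hR
    rw [hMe]
    apply real_bull
    refine hcon β ?_ h2
    intro v hv
    have : v ∈ insert x (insert x' (S1 ∪ (L' : Set V))) := by rw [hSeq]; trivial
    rcases this with rfl | rfl | h
    · exact hβ
    · exact hβ'
    · exact absurd h hv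

theorem main {F M : Multiset (Sym2 V)} {β : V → ZMod 3} (hT : TT Set.univ F) (hF : F ≤ M)
    (hLL : LL M) (h2 : ∑ v, β v = 0) (hR : ¬ Real M β) (hn : 3 ≤ Fintype.card V) :
    Out2 M ∨ Out3 M := by
  by_cases ho : Out2 M
  · exact Or.inl ho
  right
  rcases hT.shape with ⟨p, q, L, hpq, hL, hS, rfl⟩ | ⟨S0, F0, q, r, p, c, L, hT0, hqr, hp, hne, hL, hc, hS, rfl⟩
  · have hTb := TT.base p q hpq
    have hleaf := fun x hx => (star_leaf (x := x) (c := fun _ => q) hTb hL (by simp) hF hS.symm hLL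
      h2 hR hx).resolve_left ho
    have hLne : L.Nonempty := by
      by_contra h
      rw [Finset.not_nonempty_iff_eq_empty] at h
      subst h
      have h3 : (Finset.univ : Finset V) ⊆ {p, q} := by
        intro v _
        have : v ∈ (Set.univ : Set V) := trivial
        rw [hS] at this
        simpa using this
      have := (Finset.card_le_card h3).trans Finset.card_le_two
      rw [Finset.card_univ] at this
      omega
    obtain ⟨x, hx⟩ := hLne
    obtain ⟨y, hyx, hyp, hyq, hat, hβ⟩ := hleaf x hx
    have hyL : y ∈ L := by
      have : y ∈ (Set.univ : Set V) := trivial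
      rw [hS] at this
      simpa [hyp, hyq] using this
    obtain ⟨y', -, -, -, hat', hβ'⟩ := hleaf y hyL
    exact star_pair (c := fun _ => q) hTb hL (by simp) hF hS.symm h2 hR hx hyL hyx hat hβ hat' hβ'
  · have hT1 := TT.grow S0 F0 hT0 p q r hp hqr
    have hc1 : ∀ x ∈ L, s(p, c x) ∈ s(p,q) ::ₘ s(p,r) ::ₘ F0 := by
      intro x hx; rcases hc x hx with h | h <;> simp [h]
    have hleaf := fun x hx => (star_leaf (x := x) hT1 hL hc1 hF hS.symm hLL
      h2 hR hx).resolve_left ho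
    choose! y hyx hyp hyc hat hβ using hleaf
    by_cases hpair : ∃ x ∈ L, y x ∈ L
    · obtain ⟨x, hx, hyL⟩ := hpair
      exact star_pair hT1 hL hc1 hF hS.symm h2 hR hx hyL (hyx x hx) (hat x hx) (hβ x hx)
        (hat _ hyL) (hβ _ hyL)
    push Not at hpair
    have hq : q ∈ S0 := hT0.ins _ hqr q (by simp)
    have hr : r ∈ S0 := hT0.ins _ hqr r (by simp)
    have hcS : ∀ x ∈ L, c x ∈ S0 := by
      intro x hx; rcases hc x hx with h | h <;> rw [h] <;> assumption
    have hyS : ∀ x ∈ L, y x ∈ S0 := by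
      intro x hx
      have : y x ∈ (Set.univ : Set V) := trivial
      rw [hS] at this
      simpa [hyp x hx, hpair x hx] using this
    have hdec := decompL M L (by
      intro e he x hx x' hx' hxe hxe'
      have h3 : e ∈ at' x M := by simp [at', he, hxe]
      rw [hat x hx] at h3
      simp only [Multiset.insert_eq_cons, Multiset.mem_cons, Multiset.mem_singleton] at h3
      have k : ∀ t, t ∈ insert p S0 → e = s(x,t) → x = x' := by
        rintro t ht rfl
        simp only [Sym2.mem_iff] at hxe'
        rcases hxe' with h | h
        · exact h.symm
        · exact absurd (h ▸ ht) (hL x' hx')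
      rcases h3 with h | h | h
      · exact k _ (by simp) h
      · exact k _ (by simp [hcS x hx]) h
      · exact k _ (by simp [hyS x hx]) h)
    set N := M.filter (fun e => ∀ x ∈ L, x ∉ e) with hN
    rw [Finset.sum_congr rfl hat] at hdec
    have hNi : Ins (insert p S0) N := by
      intro e he v hv
      have : v ∈ (Set.univ : Set V) := trivial
      rw [hS] at this
      simp only [hN, Multiset.mem_filter] at he
      rcases this with h | h
      · exact h
      · exact absurd hv (he.2 v h)
    have hFN : s(p,q) ::ₘ s(p,r) ::ₘ F0 ≤ N := by
      have h3 : (s(p,q) ::ₘ s(p,r) ::ₘ F0).filter (fun e => ∀ x ∈ L, x ∉ e) =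
          s(p,q) ::ₘ s(p,r) ::ₘ F0 :=
        Multiset.filter_eq_self.2 fun e he x hx hxe => hL x hx (hT1.ins e he x hxe)
      rw [← h3]
      refine Multiset.filter_le_filter _ (le_trans ?_ hF)
      unfold starF
      exact Multiset.le_add_right _ _
    obtain ⟨k1, k2, Ep, k3, k4, k5⟩ := leafDecomp hT0 hp hFN hNi
      (fun e he => hLL e (Multiset.mem_of_le (Multiset.filter_le _ _) he))
    have hsupp : ∀ v, v ∉ insert p S0 → β v = 0 := by
      intro v hv
      have : v ∈ (Set.univ : Set V) := trivial
      rw [hS] at this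
      rcases this with h | h
      · exact absurd h hv
      · exact hβ v h
    rcases fanK (c := c) (y := y) hT0 hp hqr k1 k2 k5 L hL (fun x hx => ⟨hcS x hx, hyS x hx⟩) β
      hsupp h2 (by rw [← k4, hdec]; exact hR) with h | ⟨x, hLx, hβp, hE⟩
    · simp [h] at hne
    subst hLx
    rw [hE, zero_add] at k4
    rw [Finset.sum_singleton] at hdec
    have hx0 : x ∉ insert p S0 := hL x (by simp)
    simp only [Set.mem_insert_iff, not_or] at hx0
    have hall : insert x (insert p S0) = Set.univ := by rw [hS]; simp
    have hMe : M = s(x,p) ::ₘ s(x,c x) ::ₘ s(x,y x) ::ₘ s(p,q) ::ₘ s(p,r) ::ₘ av p N := by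
      conv_lhs => rw [← hdec, k4]
      simp only [← Multiset.singleton_add, Multiset.insert_eq_cons]
      abel
    have fin : ∀ q r, s(q,r) ∈ F0 → c x = q →
        M = s(x,p) ::ₘ s(x,q) ::ₘ s(x,y x) ::ₘ s(p,q) ::ₘ s(p,r) ::ₘ av p N → Out3 M := by
      intro q r hqr hcq hMe
      have hMe' : M = s(x,p) ::ₘ s(x,q) ::ₘ s(p,q) ::ₘ s(x,y x) ::ₘ s(p,r) ::ₘ av p N := by
        rw [hMe]; congr 2; exact Multiset.cons_swap _ _ _
      refine ⟨x, p, q, y x, r, S0, F0, av p N, hMe', hx0.1, hx0.2, hp, hall, hT0, k1, k2, hqr,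
        hyS x (by simp), ?_, ?_⟩
      · rw [← hcq]; exact hyc x (by simp)
      · intro hcon
        apply hR
        rw [hMe']
        apply real_bull
        refine hcon β ?_ h2
        intro v hv
        by_cases hvp : v = p
        · rw [hvp, hβp]
        · exact hsupp v (by simp [hvp, hv])
    rcases hc x (by simp) with h | h
    · exact fin q r hqr h (hMe.trans (by rw [h]))
    · refine fin r q (by rw [Sym2.eq_swap]; exact hqr) h ?_
      rw [h] at hMe
      rw [hMe]
      congr 3
      exact Multiset.cons_swap _ _ _


theorem exists_pair (z : Sym2 V) : ∃ p : V × V, z = s(p.1, p.2) := by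
  induction z with
  | h a b => exact ⟨(a, b), rfl⟩

theorem realA {E : Type} (f : E → Sym2 V) (A : Finset E) : ∀ β : V → ZMod 3,
    Real (A.val.map f) β ↔ ∃ D : E → V × V, (∀ e, f e = s((D e).1, (D e).2)) ∧
      ∑ e ∈ A, d (D e).1 (D e).2 = β := by
  intro β
  constructor
  · induction A using Finset.induction_on generalizing β with
    | empty =>
      intro h
      simp only [Finset.empty_val, Multiset.map_zero, real_zero] at h
      choose D hD using fun e => exists_pair (f e)
      exact ⟨D, hD, by simp [h]⟩
    | insert e A he ih =>
      intro h
      rw [Finset.insert_val_of_notMem he, Multiset.map_cons] at h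
      obtain ⟨⟨a, b⟩, hab⟩ := exists_pair (f e)
      rw [hab, real_cons] at h
      obtain ⟨ε, hε, h⟩ := h
      obtain ⟨D, hD, hs⟩ := ih _ h
      have key : ∀ p : V × V, f e = s(p.1, p.2) → ε • d a b = d p.1 p.2 → 
          ∃ D : E → V × V, (∀ e, f e = s((D e).1, (D e).2)) ∧
            ∑ e ∈ insert e A, d (D e).1 (D e).2 = β := by
        intro p hp hd
        refine ⟨Function.update D e p, ?_, ?_⟩
        · intro e'
          by_cases h : e' = e
          · subst h; simpa using hp
          · simpa [h] using hD e'
        · rw [Finset.sum_insert he, Function.update_self, ← hd]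
          have : ∑ x ∈ A, d (Function.update D e p x).1 (Function.update D e p x).2 =
              ∑ x ∈ A, d (D x).1 (D x).2 := by
            refine Finset.sum_congr rfl fun x hx => ?_
            have : x ≠ e := by rintro rfl; exact he hx
            simp [this]
          rw [this, hs]; abel
      rcases hε with rfl | rfl
      · exact key (a, b) hab (by simp)
      · exact key (b, a) (by rw [hab]; exact Sym2.eq_swap) (by simp [d_swap a b])
  · rintro ⟨D, hD, hs⟩
    refine ⟨A.val.map D, ?_, ?_⟩
    · rw [Multiset.map_map]
      exact Multiset.map_congr rfl fun e _ => (hD e).symm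
    · rw [Multiset.map_map]; exact hs

theorem deg_eq {E : Type} [Fintype E] (D : E → V × V) (F : Set E) (v : V) :
    (({e : E | e ∈ F ∧ (D e).1 = v}.ncard : ZMod 3)
        - ({e : E | e ∈ F ∧ (D e).2 = v}.ncard : ZMod 3)) =
      (∑ e ∈ F.toFinset, d (D e).1 (D e).2) v := by
  have h : ∀ g : E → V, ({e : E | e ∈ F ∧ g e = v}.ncard : ZMod 3) =
      ∑ e ∈ F.toFinset, if v = g e then 1 else 0 := by
    intro g
    rw [Finset.sum_boole, Set.ncard_eq_toFinset_card']
    congr 2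
    ext e
    simp [eq_comm]
  rw [h (fun e => (D e).1), h (fun e => (D e).2), Finset.sum_apply, ← Finset.sum_sub_distrib]
  rfl

end BG

open BG

namespace Multigraph

noncomputable def em (G : Multigraph) : Multiset (Sym2 G.V) := Finset.univ.val.map G.ends

theorem outdeg_eq (G : Multigraph) (D : G.E → G.V × G.V) (v : G.V) :
    ((G.outDeg D v : ZMod 3) - (G.inDeg D v : ZMod 3)) =
      (∑ e, d (D e).1 (D e).2) v := by
  have := deg_eq D Set.univ v
  simp only [Set.mem_univ, true_and, Set.toFinset_univ] at this
  exact this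

theorem z3_map (H : Multigraph) {V : Type} [Fintype V] (φ : H.V → V) (hφ : Function.Injective φ) :
    H.Z3Connected ↔ Conn (Set.range φ) (Finset.univ.val.map fun e => Sym2.map φ (H.ends e)) := by
  have hd : ∀ a b h, d (φ a) (φ b) (φ h) = d a b h := by
    intro a b h; simp [d, hφ.eq_iff]
  have hsum : ∀ β : V → ZMod 3, (∀ v, v ∉ Set.range φ → β v = 0) →
      ∑ v, β v = ∑ h, β (φ h) := by
    intro β h1
    refine Eq.trans ?_ (Finset.sum_map Finset.univ ⟨φ, hφ⟩ β)
    symm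
    refine Finset.sum_subset (Finset.subset_univ _) fun x _ hx => h1 x ?_
    rintro ⟨y, rfl⟩
    exact hx (by simp)
  constructor
  · intro h β h1 h2
    rw [hsum β h1] at h2
    obtain ⟨D, hD, hb⟩ := h (fun x => β (φ x)) h2
    rw [realA]
    refine ⟨fun e => (φ (D e).1, φ (D e).2), fun e => by rw [hD e]; rfl, ?_⟩
    funext v
    by_cases hv : v ∈ Set.range φ
    · obtain ⟨x, rfl⟩ := hv
      rw [← hb x, outdeg_eq, Finset.sum_apply, Finset.sum_apply]
      exact Finset.sum_congr rfl fun e _ => hd _ _ _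
    · rw [h1 v hv, Finset.sum_apply]
      refine Finset.sum_eq_zero fun e _ => ?_
      have k : ∀ a, v ≠ φ a := by rintro a rfl; exact hv ⟨a, rfl⟩
      simp [d, k]
  · intro h β h2
    have hext : ∀ x, Function.extend φ β 0 (φ x) = β x := fun x => hφ.extend_apply _ _ _
    have hs : ∀ v, v ∉ Set.range φ → Function.extend φ β 0 v = 0 := by
      intro v hv
      rw [Function.extend_apply']
      · rfl
      · rintro ⟨a, rfl⟩; exact hv ⟨a, rfl⟩
    have h3 := h (Function.extend φ β 0) hs (by rw [hsum _ hs]; simpa [hext] using h2)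
    rw [realA] at h3
    obtain ⟨D, hD, hb⟩ := h3
    have hl : ∀ e, ∃ p : H.V × H.V, H.ends e = s(p.1, p.2) ∧ φ p.1 = (D e).1 ∧ φ p.2 = (D e).2 := by
      intro e
      obtain ⟨⟨a, b⟩, hab⟩ := exists_pair (H.ends e)
      have := hD e
      rw [hab, Sym2.map_mk, Sym2.eq_iff] at this
      rcases this with ⟨h, h'⟩ | ⟨h, h'⟩
      · exact ⟨(a, b), hab, h, h'⟩
      · exact ⟨(b, a), hab.trans Sym2.eq_swap, h', h⟩
    choose D0 a1 a2 a3 using hl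
    refine ⟨D0, a1, fun x => ?_⟩
    rw [outdeg_eq, ← hext x, ← hb, Finset.sum_apply, Finset.sum_apply]
    refine Finset.sum_congr rfl fun e _ => ?_
    rw [← a2, ← a3, hd]

theorem z3_iff (G : Multigraph) : G.Z3Connected ↔ Conn Set.univ G.em := by
  have := z3_map G id Function.injective_id
  simpa [em] using this

theorem subz3_iff (G : Multigraph) (S : Set G.V) (F : Set G.E) (hs : G.Subgraph S F) :
    G.SubZ3Connected S F ↔ Conn S (F.toFinset.val.map G.ends) := by
  unfold SubZ3Connected Conn
  refine forall_congr' fun β => forall_congr' fun h1 => forall_congr' fun h2 => ?_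
  rw [realA]
  refine exists_congr fun D => and_congr_right fun hD => ?_
  constructor
  · intro h
    funext v
    rw [← deg_eq]
    by_cases hv : v ∈ S
    · exact h v hv
    · rw [deg_eq, h1 v hv, Finset.sum_apply]
      refine Finset.sum_eq_zero fun e he => ?_
      have he' : e ∈ F := by simpa using he
      have k1 : v ≠ (D e).1 := by
        rintro rfl; exact hv (hs e he' _ (by rw [hD e]; simp))
      have k2 : v ≠ (D e).2 := by
        rintro rfl; exact hv (hs e he' _ (by rw [hD e]; simp))
      simp [d, k1, k2]
  · intro h v hv
    rw [deg_eq, h]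

theorem map_erase' {E W : Type} (f : E → W) (A : Finset E) (e : E) (he : e ∈ A) :
    A.val.map f = f e ::ₘ (A.erase e).val.map f := by
  rw [← Multiset.map_cons, Finset.erase_val, Multiset.cons_erase (Finset.mem_def.1 he)]

theorem map_cons' {E W : Type} (f : E → W) (A : Finset E) (s : W) (M : Multiset W)
    (h : A.val.map f = s ::ₘ M) : ∃ e ∈ A, f e = s ∧ (A.erase e).val.map f = M := by
  have h1 : s ∈ A.val.map f := by rw [h]; simp
  obtain ⟨e, he, rfl⟩ := Multiset.mem_map.1 h1
  refine ⟨e, he, rfl, ?_⟩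
  rw [map_erase' f A e he, Multiset.cons_inj_right] at h
  exact h

theorem em_ll (G : Multigraph) : LL G.em := by
  intro e he
  obtain ⟨x, -, rfl⟩ := Multiset.mem_map.1 he
  exact G.loopless x

theorem tree_tt (G : Multigraph) {S : Set G.V} {F : Set G.E} (h : G.IsTriangleTree S F) :
    ∃ F' : Multiset (Sym2 G.V), TT S F' ∧ (∀ e ∈ F, G.ends e ∈ F') ∧
      (∀ f ∈ F', f ∈ G.em) := by
  have hm : ∀ e, G.ends e ∈ G.em := fun e => Multiset.mem_map.2 ⟨e, by simp, rfl⟩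
  induction h with
  | base x y z e1 e2 e3 hxy hxz hyz h1 h2 h3 =>
    refine ⟨_, TT.grow _ _ (TT.base y z hyz) x y z (by simp [hxy, hxz]) (by simp), ?_, ?_⟩
    · intro e he
      rcases he with rfl | rfl | rfl <;> simp [*]
    · intro f hf
      simp only [Multiset.mem_cons, Multiset.mem_singleton] at hf
      rcases hf with rfl | rfl | rfl
      · rw [← h1]; exact hm _
      · rw [← h3]; exact hm _
      · rw [← h2]; exact hm _
  | grow S F hT v a b hv e he hab e1 e2 h1 h2 ih =>
    obtain ⟨F', i1, i2, i3⟩ := ih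
    refine ⟨_, TT.grow _ _ i1 v a b hv (hab ▸ i2 e he), ?_, ?_⟩
    · intro e he
      rcases he with rfl | rfl | he
      · simp [h1]
      · simp [h2]
      · simp [i2 e he]
    · intro f hf
      simp only [Multiset.mem_cons] at hf
      rcases hf with rfl | rfl | hf
      · rw [← h1]; exact hm _
      · rw [← h2]; exact hm _
      · exact i3 f hf

theorem tt_tree (H : Multigraph) {V : Type} [Fintype V] (φ : H.V → V)
    (hφ : Function.Injective φ) (A : Set H.E) {S : Set V} {F : Multiset (Sym2 V)} (hT : TT S F) :
    S ⊆ Set.range φ → (∀ f ∈ F, ∃ e ∈ A, Sym2.map φ (H.ends e) = f) →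
    (∃ a b, a ≠ b ∧ S = {a, b} ∧ F = {s(a,b)}) ∨
    (∃ F' ⊆ A, H.IsTriangleTree (φ ⁻¹' S) F' ∧ ∀ f ∈ F, ∃ e ∈ F', Sym2.map φ (H.ends e) = f) := by
  have hinj : Function.Injective (Sym2.map φ) := Sym2.map.injective hφ
  have hpre : ∀ (v : H.V) (S : Set V), φ ⁻¹' (insert (φ v) S) = insert v (φ ⁻¹' S) := by
    intro v S; ext x; simp [hφ.eq_iff]
  induction hT with
  | base a b h => intro _ _; exact Or.inl ⟨a, b, h, rfl, rfl⟩
  | grow S F hT v a b hv hab ih =>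
    intro hS hA
    right
    have ha := hT.ins _ hab a (by simp)
    have hb := hT.ins _ hab b (by simp)
    have hl := hT.ll _ hab
    obtain ⟨v, rfl⟩ := hS (Set.mem_insert _ _)
    obtain ⟨a, rfl⟩ := hS (Set.mem_insert_of_mem _ ha)
    obtain ⟨b, rfl⟩ := hS (Set.mem_insert_of_mem _ hb)
    have key : ∀ x y e, Sym2.map φ (H.ends e) = s(φ x, φ y) → H.ends e = s(x,y) := by
      intro x y e h; exact hinj (by rw [h]; rfl)
    obtain ⟨e1, he1, h1⟩ := hA s(φ v, φ a) (by simp)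
    obtain ⟨e2, he2, h2⟩ := hA s(φ v, φ b) (by simp)
    rcases ih (fun x hx => hS (Set.mem_insert_of_mem _ hx)) (fun f hf => hA f (by simp [hf])) with
      ⟨c, c', hcc, rfl, rfl⟩ | ⟨F', i1, i2, i3⟩
    · simp only [Multiset.mem_singleton] at hab
      have hSe : ({c, c'} : Set V) = {φ a, φ b} := by
        rw [Sym2.eq_iff] at hab
        rcases hab with ⟨rfl, rfl⟩ | ⟨rfl, rfl⟩
        · rfl
        · exact Set.pair_comm _ _
      obtain ⟨e3, he3, h3⟩ := hA s(φ a, φ b) (by simp [hab])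
      have hab' : a ≠ b := by rintro rfl; simp at hl
      have hva : v ≠ a := by rintro rfl; exact hv ha
      have hvb : v ≠ b := by rintro rfl; exact hv hb
      refine ⟨{e1, e3, e2}, ?_, ?_, ?_⟩
      · rintro e (rfl | rfl | rfl) <;> assumption
      · have := IsTriangleTree.base (G := H) v a b e1 e3 e2 hva hvb hab' (key _ _ _ h1)
          (key _ _ _ h3) (key _ _ _ h2)
        convert this using 1
        rw [hSe]; ext x; simp [hφ.eq_iff]
      · intro f hf
        rw [← hab] at hf
        simp only [Multiset.mem_cons, Multiset.mem_singleton] at hf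
        rcases hf with rfl | rfl | rfl
        · exact ⟨e1, by simp, h1⟩
        · exact ⟨e2, by simp, h2⟩
        · exact ⟨e3, by simp, h3⟩
    · obtain ⟨e, he, hee⟩ := i3 _ hab
      refine ⟨insert e1 (insert e2 F'), ?_, ?_, ?_⟩
      · rintro e (rfl | rfl | he)
        · assumption
        · assumption
        · exact i1 he
      · rw [hpre]
        exact IsTriangleTree.grow _ _ i2 v a b hv e he (key _ _ _ hee) e1 e2 (key _ _ _ h1)
          (key _ _ _ h2)
      · intro f hf
        simp only [Multiset.mem_cons] at hf
        rcases hf with rfl | rfl | hf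
        · exact ⟨e1, by simp, h1⟩
        · exact ⟨e2, by simp, h2⟩
        · obtain ⟨e, he, h⟩ := i3 f hf
          exact ⟨e, by simp [he], h⟩

theorem complete_iff (G : Multigraph) (n : ℕ) : G.IsCompleteGraphOn n ↔
    Fintype.card G.V = n ∧ G.em.Nodup ∧ ∀ f : Sym2 G.V, ¬ f.IsDiag → f ∈ G.em := by
  constructor
  · rintro ⟨φ, ψ, h⟩
    have hinj : Function.Injective (Sym2.map φ) := Sym2.map.injective φ.injective
    refine ⟨by simpa using Fintype.card_congr φ, ?_, ?_⟩
    · refine Multiset.Nodup.map ?_ Finset.univ.nodup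
      intro e e' hee
      apply ψ.injective
      apply Subtype.ext
      rw [← h, ← h, hee]
    · intro f hf
      have hf' : ¬ (Sym2.map φ f).IsDiag := by
        induction f with
        | h a b => simpa using hf
      refine Multiset.mem_map.2 ⟨ψ.symm ⟨_, hf'⟩, by simp, ?_⟩
      apply hinj
      rw [h]; simp
  · rintro ⟨h1, h2, h3⟩
    let φ : G.V ≃ Fin n := Fintype.equivFinOfCardEq h1
    have hinj : Function.Injective (Sym2.map φ) := Sym2.map.injective φ.injective
    have hd : ∀ f : Sym2 G.V, (Sym2.map φ f).IsDiag ↔ f.IsDiag := by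
      intro f
      induction f with
      | h a b => simp
    let ψ : G.E → {p : Sym2 (Fin n) // ¬ p.IsDiag} := fun e =>
      ⟨Sym2.map φ (G.ends e), by rw [hd]; exact G.loopless e⟩
    have hb : Function.Bijective ψ := by
      constructor
      · intro e e' h
        have h4 : G.ends e = G.ends e' := hinj (congrArg Subtype.val h)
        exact Multiset.inj_on_of_nodup_map h2 e (by simp) e' (by simp) h4
      · rintro ⟨p, hp⟩
        have hps : Sym2.map φ (Sym2.map φ.symm p) = p := by
          rw [Sym2.map_map]; simp
        have := h3 (Sym2.map φ.symm p) (by rw [← hd, hps]; exact hp)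
        obtain ⟨e, -, he⟩ := Multiset.mem_map.1 this
        exact ⟨e, Subtype.ext (by simp only [ψ]; rw [he, hps])⟩
    exact ⟨φ, Equiv.ofBijective ψ hb, fun e => rfl⟩


end Multigraph

namespace BG

variable {V : Type} [Fintype V]

theorem conn_leaf {x a b : V} {M0 : Multiset (Sym2 V)} {S0 : Set V}
    (h : Conn Set.univ (s(x,a) ::ₘ s(x,b) ::ₘ M0)) (hx : ∀ e ∈ M0, x ∉ e)
    (hxa : x ≠ a) (hxb : x ≠ b) (hS : x ∉ S0) : Conn S0 M0 := by
  intro β h1 h2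
  have h3 := h (β + d x a + d x b) (by simp) (by simp [Finset.sum_add_distrib, h2, sum_d])
  rw [real_cons] at h3
  obtain ⟨ε, hε, h3⟩ := h3
  rw [real_cons] at h3
  obtain ⟨ε', hε', h3⟩ := h3
  have h4 := real_supp h3 hx
  simp [d, hxa, hxb, h1 x hS] at h4
  have h5 : ε = 1 ∧ ε' = 1 := by
    clear h3
    revert ε ε'; decide
  obtain ⟨rfl, rfl⟩ := h5
  convert h3 using 1
  rw [one_smul, one_smul]; abel

theorem conn_bull {u v w a b : V} {M0 : Multiset (Sym2 V)} {S0 : Set V}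
    (h : Conn Set.univ (s(u,v) ::ₘ s(u,w) ::ₘ s(v,w) ::ₘ s(u,a) ::ₘ s(v,b) ::ₘ M0))
    (hu : ∀ e ∈ M0, u ∉ e) (hv : ∀ e ∈ M0, v ∉ e) (huv : u ≠ v) (huw : u ≠ w) (hvw : v ≠ w)
    (hua : u ≠ a) (hva : v ≠ a) (hub : u ≠ b) (hvb : v ≠ b)
    (hSu : u ∉ S0) (hSv : v ∉ S0) : Conn S0 (s(a,b) ::ₘ M0) := by
  intro β h1 h2
  have h3 := h β (by simp) h2
  rw [real_cons] at h3
  obtain ⟨ε1, hε1, h3⟩ := h3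
  rw [real_cons] at h3
  obtain ⟨ε2, hε2, h3⟩ := h3
  rw [real_cons] at h3
  obtain ⟨ε3, hε3, h3⟩ := h3
  rw [real_cons] at h3
  obtain ⟨ε4, hε4, h3⟩ := h3
  rw [real_cons] at h3
  obtain ⟨ε5, hε5, h3⟩ := h3
  have h4 := real_supp h3 hu
  have h5 := real_supp h3 hv
  simp [d, huv, huw, hua, hub, h1 u hSu] at h4
  simp [d, huv.symm, hvw, hva, hvb, h1 v hSv] at h5
  have h6 : ε2 = ε1 ∧ ε4 = ε1 ∧ ε3 = -ε1 ∧ ε5 = -ε1 := by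
    have k1 : ∀ x y z : ZMod 3, (x = 1 ∨ x = -1) → (y = 1 ∨ y = -1) → (z = 1 ∨ z = -1) →
        -x - y - z = 0 → y = x ∧ z = x := by decide
    have k2 : ∀ x y z : ZMod 3, (x = 1 ∨ x = -1) → (y = 1 ∨ y = -1) → (z = 1 ∨ z = -1) →
        x - y - z = 0 → y = -x ∧ z = -x := by decide
    obtain ⟨p1, p2⟩ := k1 _ _ _ hε1 hε2 hε4 h4
    obtain ⟨p3, p4⟩ := k2 _ _ _ hε1 hε3 hε5 h5
    exact ⟨p1, p2, p3, p4⟩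
  obtain ⟨rfl, rfl, rfl, rfl⟩ := h6
  refine Real.cons (-ε4) (by clear h3 h4 h5; revert ε4; decide) ?_
  convert h3 using 1
  funext x
  have h7 : (3 : ZMod 3) = 0 := by decide
  simp only [d, Pi.sub_apply, Pi.smul_apply, smul_eq_mul]
  linear_combination (ε4 * (if x = u then 1 else 0) - ε4 * (if x = v then 1 else 0)) * h7

theorem conn_loop {a : V} {M0 : Multiset (Sym2 V)} {S0 : Set V}
    (h : Conn S0 (s(a,a) ::ₘ M0)) : Conn S0 M0 := by
  intro β h1 h2
  have h3 := h β h1 h2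
  rw [real_cons] at h3
  obtain ⟨ε, -, h3⟩ := h3
  simpa [d_self] using h3

theorem noConn {a b : V} (hab : a ≠ b) (S : Set V) : ¬ Conn S {s(a,b)} := by
  intro h
  have h3 := h 0 (by simp) (by simp)
  rw [← Multiset.cons_zero, real_cons] at h3
  obtain ⟨ε, hε, h3⟩ := h3
  rw [real_zero] at h3
  have := congrFun h3 a
  simp [d, hab] at this
  subst this
  revert hε; decide

theorem two_edge {a b : V} {M : Multiset (Sym2 V)} (hab : a ≠ b) (h1 : s(a,b) ∈ M)
    (hi : Ins {a, b} M) (hl : LL M) (hc : ¬ Conn {a, b} M) : M = {s(a,b)} := by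
  obtain ⟨N, rfl⟩ := Multiset.exists_cons_of_mem h1
  by_cases hN : N = 0
  · subst hN; rfl
  · exfalso
    obtain ⟨e, he⟩ := Multiset.exists_mem_of_ne_zero hN
    have he' : e = s(a,b) := by
      have h2 := hi e (by simp [he])
      have h3 := hl e (by simp [he])
      induction e with
      | h p q =>
      have hp := h2 p (by simp)
      have hq := h2 q (by simp)
      simp only [Set.mem_insert_iff, Set.mem_singleton_iff, Sym2.mk_isDiag_iff] at hp hq h3
      rcases hp with rfl | rfl <;> rcases hq with rfl | rfl <;> simp_all
    subst he'
    obtain ⟨N, rfl⟩ := Multiset.exists_cons_of_mem he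
    refine hc (double_real (TT.base a b hab) hi (by simp : s(a,b) ∈ _) ?_)
    exact Multiset.cons_le_cons _ (by simp)

theorem lift_sym {S : Set V} (f : Sym2 V) (h : ∀ v ∈ f, v ∈ S) :
    ∃ z : Sym2 S, Sym2.map Subtype.val z = f := by
  induction f with
  | h a b => exact ⟨s(⟨a, h a (by simp)⟩, ⟨b, h b (by simp)⟩), rfl⟩

end BG

namespace Multigraph

theorem two_sum_back (G : Multigraph) {x a b : G.V} {SB : Set G.V} {FB : Set G.E}
    (h : G.Subgraph SB FB) (e1 e2 e3 : G.E) (h1 : G.ends e1 = s(x,a)) (h2 : G.ends e2 = s(x,b))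
    (hab : a ≠ b) (hx : x ∉ SB) (hcov : ∀ e, e = e1 ∨ e = e2 ∨ e = e3 ∨ e ∈ FB)
    (hne : ∃ e, (e = e1 ∨ e = e2 ∨ e = e3) ∧ e ∈ FB) (hz : G.Z3Connected) :
    G.SubZ3Connected SB FB := by
  have n1 : e1 ∉ FB := fun h' => hx (h _ h' x (by simp [h1]))
  have n2 : e2 ∉ FB := fun h' => hx (h _ h' x (by simp [h2]))
  have n3 : e3 ∈ FB := by
    obtain ⟨e, rfl | rfl | rfl, h'⟩ := hne
    · exact absurd h' n1
    · exact absurd h' n2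
    · exact h'
  have l1 := G.loopless e1
  have l2 := G.loopless e2
  rw [h1] at l1
  rw [h2] at l2
  simp only [Sym2.mk_isDiag_iff] at l1 l2
  have n12 : e2 ≠ e1 := by
    rintro rfl
    rw [h1, Sym2.eq_iff] at h2
    rcases h2 with ⟨-, h2⟩ | ⟨h2, -⟩
    · exact hab h2
    · exact l2 h2
  have hem : G.em = s(x,a) ::ₘ s(x,b) ::ₘ FB.toFinset.val.map G.ends := by
    rw [em, map_erase' _ _ e1 (Finset.mem_univ _), map_erase' _ _ e2 (by simp [n12]), h1, h2]
    congr 4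
    ext e
    simp only [Finset.mem_erase, Finset.mem_univ, Set.mem_toFinset]
    constructor
    · rintro ⟨h, h', -⟩
      rcases hcov e with rfl | rfl | rfl | h''
      · exact absurd rfl h'
      · exact absurd rfl h
      · exact n3
      · exact h''
    · intro h'
      refine ⟨?_, ?_, trivial⟩
      · rintro rfl; exact n2 h'
      · rintro rfl; exact n1 h'
  rw [subz3_iff _ _ _ h]
  rw [z3_iff, hem] at hz
  refine conn_leaf hz ?_ l1 l2 hx
  intro f hf
  obtain ⟨e, he, rfl⟩ := Multiset.mem_map.1 hf
  intro h'
  exact hx (h e (by simpa using he) x h')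

theorem twosum_case (G : Multigraph) {SA SB : Set G.V} {FA FB : Set G.E}
    (h : G.IsTwoSum SA FA SB FB) (ht : G.IsTriangleSub SA FA) (hz : G.Z3Connected) :
    G.SubZ3Connected SB FB := by
  obtain ⟨x, y, z, e1, e2, e3, hxy, hxz, hyz, h1, h2, h3, rfl, rfl⟩ := ht
  obtain ⟨-, hs, hu, h4, h5⟩ := h
  have hcov : ∀ e, e = e1 ∨ e = e2 ∨ e = e3 ∨ e ∈ FB := by
    intro e
    have : e ∈ ({e1, e2, e3} ∪ FB : Set G.E) := by rw [hu]; trivial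
    simp only [Set.mem_union, Set.mem_insert_iff, Set.mem_singleton_iff] at this
    tauto
  have hne : ∃ e, (e = e1 ∨ e = e2 ∨ e = e3) ∧ e ∈ FB := by
    rw [Set.ncard_eq_one] at h4
    obtain ⟨e, he⟩ := h4
    have : e ∈ ({e1, e2, e3} ∩ FB : Set G.E) := by rw [he]; rfl
    exact ⟨e, by simpa using this.1, this.2⟩
  by_cases hx : x ∈ SB
  · by_cases hy : y ∈ SB
    · by_cases hz' : z ∈ SB
      · exfalso
        have : ({x, y, z} ∩ SB : Set G.V) = {x, y, z} := by
          rw [Set.inter_eq_left]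
          rintro v (rfl | rfl | rfl) <;> assumption
        rw [this, Set.ncard_eq_three.2 ⟨x, y, z, hxy, hxz, hyz, rfl⟩] at h5
        omega
      · refine two_sum_back G hs e2 e3 e1 (h2.trans Sym2.eq_swap) (h3.trans Sym2.eq_swap)
          hxy.symm hz' ?_ ?_ hz
        · intro e; have := hcov e; tauto
        · obtain ⟨e, he, he'⟩ := hne; exact ⟨e, by tauto, he'⟩
    · refine two_sum_back G hs e1 e2 e3 (h1.trans Sym2.eq_swap) h2 hxz hy hcov hne hz
  · refine two_sum_back G hs e1 e3 e2 h1 h3 hyz hx ?_ ?_ hz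
    · intro e; have := hcov e; tauto
    · obtain ⟨e, he, he'⟩ := hne; exact ⟨e, by tauto, he'⟩

theorem five (G : Multigraph) {e1 e2 e3 e4 e5 : G.E} (h12 : e1 ≠ e2) (h13 : e1 ≠ e3)
    (h14 : e1 ≠ e4) (h15 : e1 ≠ e5) (h23 : e2 ≠ e3) (h24 : e2 ≠ e4) (h25 : e2 ≠ e5)
    (h34 : e3 ≠ e4) (h35 : e3 ≠ e5) (h45 : e4 ≠ e5) :
    G.em = G.ends e1 ::ₘ G.ends e2 ::ₘ G.ends e3 ::ₘ G.ends e4 ::ₘ G.ends e5 ::ₘ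
      (Finset.univ.filter fun e => e ∉ ({e1, e2, e3, e4, e5} : Set G.E)).val.map G.ends := by
  rw [em, map_erase' _ _ e1 (Finset.mem_univ _), map_erase' _ _ e2 (by simp [h12.symm]),
    map_erase' _ _ e3 (by simp [h13.symm, h23.symm]),
    map_erase' _ _ e4 (by simp [h14.symm, h24.symm, h34.symm]),
    map_erase' _ _ e5 (by simp [h15.symm, h25.symm, h35.symm, h45.symm])]
  congr 7
  ext e
  simp only [Finset.mem_erase, Finset.mem_univ, Finset.mem_filter, Set.mem_insert_iff,
    Set.mem_singleton_iff]
  tauto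

theorem bull_back (G H : Multigraph) (h : G.IsBullGrowing H) (hz : G.Z3Connected) :
    H.Z3Connected := by
  obtain ⟨u, v, w, a, b, e1, e2, e3, e4, e5, h1, h2, h3, h4, h5, hav, hbu, n12, n14, n24,
    n13, n15, n35, hu, hv, φ, hφ, hr, hc1, hc2⟩ := h
  have l1 := G.loopless e1
  have l2 := G.loopless e2
  have l3 := G.loopless e3
  have l4 := G.loopless e4
  have l5 := G.loopless e5
  rw [h1] at l1
  rw [h2] at l2
  rw [h3] at l3
  rw [h4] at l4
  rw [h5] at l5
  simp only [Sym2.mk_isDiag_iff] at l1 l2 l3 l4 l5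
  have key : ∀ e e', u ∈ G.ends e → u ∉ G.ends e' → e ≠ e' := by
    rintro e e' h h' rfl; exact h' h
  have u3 : u ∉ G.ends e3 := by rw [h3]; simp [l1, l2]
  have u5 : u ∉ G.ends e5 := by rw [h5]; simp [l1, hbu.symm]
  have n23 : e2 ≠ e3 := key _ _ (by simp [h2]) u3
  have n25 : e2 ≠ e5 := key _ _ (by simp [h2]) u5
  have n34 : e3 ≠ e4 := (key _ _ (by simp [h4]) u3).symm
  have n45 : e4 ≠ e5 := key _ _ (by simp [h4]) u5
  have hem := five G n12 n13 n14 n15 n23 n24 n25 n34 n35 n45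
  rw [h1, h2, h3, h4, h5] at hem
  rw [z3_iff, hem] at hz
  have hb := conn_bull (S0 := Set.range φ) hz ?_ ?_ l1 l2 l3 l4 hav.symm hbu.symm l5
    (by simp [hr]) (by simp [hr])
  · rw [z3_map H φ hφ]
    by_cases hab : a = b
    · obtain ⟨ψ, hψ, hψr, hψe⟩ := hc1 hab
      subst hab
      convert conn_loop hb using 1
      have : (Finset.univ.filter fun e => e ∉ ({e1, e2, e3, e4, e5} : Set G.E)) =
          Finset.univ.map ⟨ψ, hψ⟩ := by
        ext e
        have h6 : e ∈ Set.range ψ ↔ e ∈ {e : G.E | e ∉ ({e1, e2, e3, e4, e5} : Set G.E)} := by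
          rw [hψr]
        simp only [Finset.mem_filter, Finset.mem_univ, true_and, Finset.mem_map,
          Function.Embedding.coeFn_mk]
        exact h6.symm
      rw [this, Finset.map_val, Multiset.map_map]
      exact Multiset.map_congr rfl fun e _ => (hψe e).symm
    · obtain ⟨e0, ψ, h0, hψ, hψr, hψe⟩ := hc2 hab
      convert hb using 1
      rw [map_erase' _ _ e0 (Finset.mem_univ _), h0]
      congr 1
      have : (Finset.univ.filter fun e => e ∉ ({e1, e2, e3, e4, e5} : Set G.E)) =
          (Finset.univ.erase e0).image ψ := by
        ext e
        have h6 : e ∈ ψ '' {e : H.E | e ≠ e0} ↔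
            e ∈ {e : G.E | e ∉ ({e1, e2, e3, e4, e5} : Set G.E)} := by
          rw [hψr]
        simp only [Finset.mem_filter, Finset.mem_univ, true_and, Finset.mem_image,
          Finset.mem_erase, and_true]
        exact h6.symm
      rw [this, Finset.image_val_of_injOn (by simpa [Set.InjOn] using hψ), Multiset.map_map]
      refine Multiset.map_congr rfl fun e he => (hψe e ?_).symm
      have : e ∈ Finset.univ.erase e0 := he
      simpa using this
  · intro f hf h'
    obtain ⟨e, he, rfl⟩ := Multiset.mem_map.1 hf
    have he' : e ∈ Finset.univ.filter fun e => e ∉ ({e1, e2, e3, e4, e5} : Set G.E) := he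
    have : e ∈ ({e1, e2, e4} : Set G.E) := by rw [← hu]; exact h'
    simp only [Finset.mem_filter, Set.mem_insert_iff, Set.mem_singleton_iff] at he' this
    tauto
  · intro f hf h'
    obtain ⟨e, he, rfl⟩ := Multiset.mem_map.1 hf
    have he' : e ∈ Finset.univ.filter fun e => e ∉ ({e1, e2, e3, e4, e5} : Set G.E) := he
    have : e ∈ ({e1, e3, e5} : Set G.E) := by rw [← hv]; exact h'
    simp only [Finset.mem_filter, Set.mem_insert_iff, Set.mem_singleton_iff] at he' this
    tauto

theorem k3_case (G : Multigraph) (h : G.IsK3) : ¬ G.Z3Connected := by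
  obtain ⟨hc, hn, hm⟩ := (complete_iff G 3).1 h
  obtain ⟨φ⟩ : Nonempty (Fin 3 ≃ G.V) := ⟨(Fintype.equivFinOfCardEq hc).symm⟩
  have hne : ∀ i j, i ≠ j → φ i ≠ φ j := fun i j h => φ.injective.ne h
  have hem : G.em = s(φ 0, φ 1) ::ₘ s(φ 0, φ 2) ::ₘ {s(φ 1, φ 2)} := by
    refine (Multiset.Nodup.ext hn ?_).2 ?_
    · simp
    · intro f
      constructor
      · intro hf
        have := G.em_ll f hf
        induction f with
        | h p q =>
        obtain ⟨i, rfl⟩ := φ.surjective p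
        obtain ⟨j, rfl⟩ := φ.surjective q
        fin_cases i <;> fin_cases j <;> simp at this ⊢
      · intro hf
        apply hm
        simp only [Multiset.mem_cons, Multiset.mem_singleton] at hf
        rcases hf with rfl | rfl | rfl <;> simp
  rw [z3_iff, hem]
  intro h
  exact noConn (hne 1 2 (by decide)) ∅ (conn_leaf h (by simp) (hne _ _ (by decide))
    (hne _ _ (by decide)) (by simp))

theorem k4_case (G : Multigraph) (h : G.IsK4) : ¬ G.Z3Connected := by
  obtain ⟨hc, hn, hm⟩ := (complete_iff G 4).1 h
  obtain ⟨φ⟩ : Nonempty (Fin 4 ≃ G.V) := ⟨(Fintype.equivFinOfCardEq hc).symm⟩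
  have hne : ∀ i j, i ≠ j → φ i ≠ φ j := fun i j h => φ.injective.ne h
  have hem : G.em = s(φ 0, φ 1) ::ₘ s(φ 0, φ 2) ::ₘ s(φ 1, φ 2) ::ₘ s(φ 0, φ 3) ::ₘ
      s(φ 1, φ 3) ::ₘ {s(φ 2, φ 3)} := by
    refine (Multiset.Nodup.ext hn ?_).2 ?_
    · simp
    · intro f
      constructor
      · intro hf
        have := G.em_ll f hf
        induction f with
        | h p q =>
        obtain ⟨i, rfl⟩ := φ.surjective p
        obtain ⟨j, rfl⟩ := φ.surjective q
        fin_cases i <;> fin_cases j <;> simp at this ⊢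
      · intro hf
        apply hm
        simp only [Multiset.mem_cons, Multiset.mem_singleton] at hf
        rcases hf with rfl | rfl | rfl | rfl | rfl | rfl <;> simp
  rw [z3_iff, hem]
  intro h
  refine noConn (hne 2 3 (by decide)) ∅ (conn_loop (conn_bull h (by simp) (by simp) ?_ ?_ ?_ ?_ ?_
    ?_ ?_ (by simp) (by simp)))
  all_goals exact hne _ _ (by decide)

theorem two_lt (G : Multigraph) {S : Set G.V} {F : Set G.E} (h : G.IsTriangleTree S F) :
    3 ≤ Fintype.card G.V := by
  induction h with
  | base x y z e1 e2 e3 hxy hxz hyz h1 h2 h3 =>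
    exact Fintype.two_lt_card_iff.2 ⟨x, y, z, hxy, hxz, hyz⟩
  | grow S F hT v a b hv e he hab e1 e2 h1 h2 ih => exact ih

/-- the graph on the vertex set `S` with the edges `f e` -/
noncomputable def mkH {V : Type} [Fintype V] (S : Set V) (E : Type) [Fintype E] (f : E → Sym2 V)
    (h : ∀ e, ∀ v ∈ f e, v ∈ S) (hl : ∀ e, ¬ (f e).IsDiag) : Multigraph where
  V := S
  E := E
  fintypeV := inferInstance
  fintypeE := inferInstance
  ends e := (lift_sym (f e) (h e)).choose
  loopless e := by
    intro hd
    have h1 := (lift_sym (f e) (h e)).choose_spec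
    refine hl e (h1 ▸ ?_)
    generalize (lift_sym (f e) (h e)).choose = z at hd
    induction z with
    | h a b =>
      simp only [Sym2.mk_isDiag_iff] at hd
      simp [hd]

theorem mkH_spec {V : Type} [Fintype V] (S : Set V) (E : Type) [Fintype E] (f : E → Sym2 V)
    (h : ∀ e, ∀ v ∈ f e, v ∈ S) (hl : ∀ e, ¬ (f e).IsDiag) (e : E) :
    Sym2.map (Subtype.val : S → V) ((mkH S E f h hl).ends e) = f e :=
  (lift_sym (f e) (h e)).choose_spec

/-- A graph on `S` whose edges are given by `f`, with a 2-tree inside. -/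
theorem mkH_ok {V : Type} [Fintype V] (S : Set V) (E : Type) [Fintype E] (f : E → Sym2 V)
    (h : ∀ e, ∀ v ∈ f e, v ∈ S) (hl : ∀ e, ¬ (f e).IsDiag) {F M : Multiset (Sym2 V)}
    (hM : Finset.univ.val.map f = M) (hT : TT S F) (hF : ∀ x ∈ F, x ∈ M) (hc : ¬ Conn S M)
    (h2 : ¬ ∃ a b, a ≠ b ∧ S = {a, b} ∧ F = {s(a,b)}) :
    ¬ (mkH S E f h hl).Z3Connected ∧ (mkH S E f h hl).HasSpanningTriangleTree := by
  let φ : (mkH S E f h hl).V → V := (Subtype.val : S → V)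
  have hφ : Function.Injective φ := Subtype.val_injective
  have hr : Set.range φ = S := Subtype.range_coe
  have hs : ∀ e, Sym2.map φ ((mkH S E f h hl).ends e) = f e := mkH_spec S E f h hl
  constructor
  · rw [z3_map _ φ hφ, hr]
    simp only [hs]
    intro h'
    apply hc
    rw [← hM]
    exact h'
  · have hA : ∀ x ∈ F, ∃ e ∈ (Set.univ : Set (mkH S E f h hl).E),
        Sym2.map φ ((mkH S E f h hl).ends e) = x := by
      intro x hx
      have := hF x hx
      rw [← hM] at this
      obtain ⟨e, -, rfl⟩ := Multiset.mem_map.1 this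
      exact ⟨e, trivial, hs e⟩
    rcases tt_tree (mkH S E f h hl) φ hφ Set.univ hT (by rw [hr]) hA with h' | ⟨F', -, h', -⟩
    · exact absurd h' h2
    · refine ⟨F', ?_⟩
      convert h' using 1
      symm
      rw [Set.eq_univ_iff_forall]
      intro x
      change φ x ∈ S
      exact hr ▸ Set.mem_range_self x

theorem out2_case (G : Multigraph) (h : Out2 G.em) : G.IsK3 ∨
      (∃ (SA : Set G.V) (FA : Set G.E) (SB : Set G.V) (FB : Set G.E),
        G.IsTwoSum SA FA SB FB ∧ G.IsTriangleSub SA FA ∧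
        ¬ G.SubZ3Connected SB FB ∧ ∃ F' ⊆ FB, G.IsTriangleTree SB F') := by
  obtain ⟨x, a, b, S0, F0, M0, hM, hT, hx, hu, hab, hF, hi, hc⟩ := h
  have ha := hT.ins _ hab a (by simp)
  have hb := hT.ins _ hab b (by simp)
  have hl := hT.ll _ hab
  simp only [Sym2.mk_isDiag_iff] at hl
  have hxa : x ≠ a := by rintro rfl; exact hx ha
  have hxb : x ≠ b := by rintro rfl; exact hx hb
  have hsub : ∀ f ∈ F0, f ∈ M0 := fun f hf => Multiset.mem_of_le hF hf
  have hLL : LL M0 := fun f hf => G.em_ll f (by rw [hM]; simp [hf])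
  obtain ⟨e1, -, h1, hM1⟩ := map_cons' _ _ _ _ hM
  obtain ⟨e2, h21, h2, hM2⟩ := map_cons' _ _ _ _ hM1
  have h21' : e2 ≠ e1 := by simpa using h21
  generalize hR : (Finset.univ.erase e1).erase e2 = R at hM2
  have hmR : ∀ e, e ∈ R ↔ e ≠ e2 ∧ e ≠ e1 := by
    intro e; rw [← hR]; simp
  have hA : ∀ f ∈ F0, ∃ e ∈ (R : Set G.E), Sym2.map id (G.ends e) = f := by
    intro f hf
    have := hsub f hf
    rw [← hM2] at this
    obtain ⟨e, he, hef⟩ := Multiset.mem_map.1 this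
    exact ⟨e, he, by simpa using hef⟩
  rcases tt_tree G id Function.injective_id (R : Set G.E) hT (by simp) hA with
    ⟨c, c', hcc, rfl, rfl⟩ | ⟨F', hF', hT', -⟩
  · left
    have h3 := two_edge hcc (hsub _ (by simp)) hi hLL hc
    subst h3
    have hall : ∀ y, y = x ∨ y = c ∨ y = c' := by
      intro y
      have : y ∈ insert x ({c, c'} : Set G.V) := by rw [hu]; trivial
      simpa using this
    simp only [Multiset.mem_singleton] at hab
    rw [← hab] at hM
    have hall : ∀ y, y = x ∨ y = a ∨ y = b := by
      intro y
      rw [Sym2.eq_iff] at hab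
      have := hall y
      rcases hab with ⟨rfl, rfl⟩ | ⟨rfl, rfl⟩ <;> tauto
    refine (complete_iff G 3).2 ⟨?_, ?_, ?_⟩
    · rw [← Finset.card_univ, Finset.card_eq_three]
      refine ⟨x, a, b, hxa, hxb, hl, ?_⟩
      ext y; simpa using hall y
    · rw [hM]
      simp [hxa, hxb, hl, hxa.symm]
    · intro f hf
      rw [hM]
      induction f with
      | h p q =>
      simp only [Sym2.mk_isDiag_iff] at hf
      simp only [Multiset.mem_cons, Multiset.mem_singleton, Sym2.eq_iff]
      have := hall p
      have := hall q
      grind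
  · right
    obtain ⟨e3, he3, h3⟩ := hA _ hab
    simp only [Sym2.map_id', id] at h3
    have he3' : e3 ∈ R := he3
    have hsB : G.Subgraph S0 (R : Set G.E) := by
      intro e he v hv
      refine hi (G.ends e) ?_ v hv
      rw [← hM2]
      exact Multiset.mem_map.2 ⟨e, he, rfl⟩
    refine ⟨{x, a, b}, {e1, e3, e2}, S0, R, ⟨?_, hsB, ?_, ?_, ?_⟩,
      ⟨x, a, b, e1, e3, e2, hxa, hxb, hl, h1, h3, h2, rfl, rfl⟩, ?_, F', hF', hT'⟩
    · intro e he v hv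
      simp only [Set.mem_insert_iff, Set.mem_singleton_iff] at he ⊢
      rcases he with rfl | rfl | rfl
      · rw [h1] at hv; simp at hv; tauto
      · rw [h3] at hv; simp at hv; tauto
      · rw [h2] at hv; simp at hv; tauto
    · ext e
      simp only [Set.mem_union, Set.mem_insert_iff, Set.mem_singleton_iff, Finset.mem_coe,
        Set.mem_univ, iff_true, hmR]
      tauto
    · rw [Set.ncard_eq_one]
      refine ⟨e3, ?_⟩
      ext e
      simp only [Set.mem_inter_iff, Set.mem_insert_iff, Set.mem_singleton_iff, Finset.mem_coe]
      constructor
      · rintro ⟨rfl | rfl | rfl, h⟩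
        · rw [hmR] at h; exact absurd rfl h.2
        · rfl
        · rw [hmR] at h; exact absurd rfl h.1
      · rintro rfl; exact ⟨by simp, he3'⟩
    · rw [Set.ncard_eq_two]
      refine ⟨a, b, hl, ?_⟩
      ext y
      simp only [Set.mem_inter_iff, Set.mem_insert_iff, Set.mem_singleton_iff]
      constructor
      · rintro ⟨rfl | h, h'⟩
        · exact absurd h' hx
        · exact h
      · rintro (rfl | rfl)
        · exact ⟨by simp, ha⟩
        · exact ⟨by simp, hb⟩
    · rw [subz3_iff _ _ _ hsB, Finset.toFinset_coe, hM2]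
      exact hc

theorem map_subtype {E W : Type} (f : E → W) (R : Finset E) :
    (Finset.univ : Finset {e // e ∈ R}).val.map (fun e => f e.1) = R.val.map f := by
  have : R.val.map f = ((Finset.univ : Finset {e // e ∈ R}).map
      (Function.Embedding.subtype _)).val.map f := by
    congr 2
    ext e
    simp
  rw [this, Finset.map_val, Multiset.map_map]
  rfl

theorem map_option {E W : Type} [Fintype E] (f : E → W) (s : W) :
    (Finset.univ : Finset (Option E)).val.map (fun o => o.elim s f) =
      s ::ₘ (Finset.univ : Finset E).val.map f := by
  rw [map_erase' _ _ none (Finset.mem_univ _)]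
  refine congrArg₂ _ rfl ?_
  trans ((Finset.univ : Finset E).map Function.Embedding.some).val.map (fun o => o.elim s f)
  · congr 2
    ext e
    cases e <;> simp
  · rw [Finset.map_val, Multiset.map_map]
    rfl

theorem out3_case (G : Multigraph) (h : Out3 G.em) : G.IsK4 ∨
      (∃ H : Multigraph, G.IsBullGrowing H ∧ ¬ H.Z3Connected ∧
        H.HasSpanningTriangleTree) := by
  obtain ⟨u, v, w, a, b, S0, F0, M0, hM, huv, hu, hv, hun, hT, hF, hi, hwb, ha, haw, hc⟩ := h
  have hw := hT.ins _ hwb w (by simp)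
  have hb := hT.ins _ hwb b (by simp)
  have hl := hT.ll _ hwb
  simp only [Sym2.mk_isDiag_iff] at hl
  have nu : ∀ y ∈ S0, u ≠ y := by rintro y h rfl; exact hu h
  have nv : ∀ y ∈ S0, v ≠ y := by rintro y h rfl; exact hv h
  have hsub : ∀ f ∈ F0, f ∈ M0 := fun f hf => Multiset.mem_of_le hF hf
  have hLL : LL M0 := fun f hf => G.em_ll f (by rw [hM]; simp [hf])
  have hall : ∀ y, y = u ∨ y = v ∨ y ∈ S0 := by
    intro y
    have : y ∈ insert u (insert v S0) := by rw [hun]; trivial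
    simpa using this
  have hc' : ¬ Conn S0 M0 := by
    intro h'
    refine hc (conn_cons h' ?_)
    intro y hy
    simp only [Sym2.mem_iff] at hy
    rcases hy with rfl | rfl <;> assumption
  by_cases h2 : ∃ a b, a ≠ b ∧ S0 = {a, b} ∧ F0 = {s(a,b)}
  · left
    obtain ⟨c, c', hcc, rfl, rfl⟩ := h2
    have h3 := two_edge hcc (hsub _ (by simp)) hi hLL hc'
    subst h3
    simp only [Multiset.mem_singleton] at hwb
    rw [← hwb] at hM
    have hall : ∀ y, y = u ∨ y = v ∨ y = w ∨ y = b := by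
      intro y
      rw [Sym2.eq_iff] at hwb
      have := hall y
      simp only [Set.mem_insert_iff, Set.mem_singleton_iff] at this
      rcases hwb with ⟨rfl, rfl⟩ | ⟨rfl, rfl⟩ <;> tauto
    have hab : a = b := by
      have h3 := hall a
      have h4 := nu a ha
      have h5 := nv a ha
      grind
    subst hab
    have uw := nu w hw
    have ua := nu a ha
    have vw := nv w hw
    have va := nv a ha
    refine (complete_iff G 4).2 ⟨?_, ?_, ?_⟩
    · rw [← Finset.card_univ]
      have : (Finset.univ : Finset G.V) = {u, v, w, a} := by
        ext y; simpa using hall y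
      rw [this]
      rw [Finset.card_insert_of_notMem, Finset.card_insert_of_notMem, Finset.card_pair hl]
      · simp [vw, va]
      · simp [huv, uw, ua]
    · rw [hM]
      simp only [Multiset.nodup_cons, Multiset.mem_cons, Multiset.mem_singleton, Sym2.eq_iff,
        Multiset.nodup_singleton]
      grind
    · intro f hf
      rw [hM]
      induction f with
      | h p q =>
      simp only [Sym2.mk_isDiag_iff] at hf
      simp only [Multiset.mem_cons, Multiset.mem_singleton, Sym2.eq_iff]
      have := hall p
      have := hall q
      grind
  · right
    obtain ⟨e1, -, h1, hM1⟩ := map_cons' _ _ _ _ hM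
    obtain ⟨e2, k2, h2', hM2⟩ := map_cons' _ _ _ _ hM1
    obtain ⟨e3, k3, h3, hM3⟩ := map_cons' _ _ _ _ hM2
    obtain ⟨e4, k4, h4, hM4⟩ := map_cons' _ _ _ _ hM3
    obtain ⟨e5, k5, h5, hM5⟩ := map_cons' _ _ _ _ hM4
    generalize hR : (((((Finset.univ.erase e1).erase e2).erase e3).erase e4).erase e5) = R at hM5
    have hmR : ∀ e, e ∈ R ↔ e ∉ ({e1, e2, e3, e4, e5} : Set G.E) := by
      intro e
      rw [← hR]
      simp only [Finset.mem_erase, Finset.mem_univ, Set.mem_insert_iff, Set.mem_singleton_iff]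
      tauto
    simp only [Finset.mem_erase, Finset.mem_univ, and_true] at k2 k3 k4 k5
    have hRM : ∀ e ∈ R, G.ends e ∈ M0 := by
      intro e he
      rw [← hM5]
      exact Multiset.mem_map.2 ⟨e, he, rfl⟩
    have hRi : ∀ e ∈ R, ∀ y ∈ G.ends e, y ∈ S0 := fun e he => hi _ (hRM e he)
    have hbull : ∀ H : Multigraph, (∃ φ : H.V → G.V, Function.Injective φ ∧
      Set.range φ = S0 ∧
      ((a = b → ∃ ψ : H.E → G.E, Function.Injective ψ ∧
          Set.range ψ = R ∧
          ∀ e, G.ends (ψ e) = Sym2.map φ (H.ends e)) ∧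
       (a ≠ b → ∃ (e0 : H.E) (ψ : H.E → G.E),
          Sym2.map φ (H.ends e0) = s(a, b) ∧
          Set.InjOn ψ {e : H.E | e ≠ e0} ∧
          ψ '' {e : H.E | e ≠ e0} = R ∧
          ∀ e, e ≠ e0 → G.ends (ψ e) = Sym2.map φ (H.ends e)))) → G.IsBullGrowing H := by
      rintro H ⟨φ, p1, p2, p3, p4⟩
      have hRset : (R : Set G.E) = {e : G.E | e ∉ ({e1, e2, e3, e4, e5} : Set G.E)} := by
        ext e; exact hmR e
      rw [hRset] at p3 p4
      refine ⟨u, v, w, a, b, e1, e2, e3, e4, e5, h1, h2', h3, h4, h5, (nv a ha).symm,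
        (nu b hb).symm, by grind, by grind, by grind, by grind, by grind, by grind, ?_, ?_,
        φ, p1, ?_, p3, p4⟩
      · ext e
        simp only [Set.mem_ofPred_eq, Set.mem_insert_iff, Set.mem_singleton_iff]
        constructor
        · intro he
          by_contra hne
          have h6 : e ∉ R := fun h' => hu (hRi e h' u he)
          rw [hmR] at h6
          simp only [Set.mem_insert_iff, Set.mem_singleton_iff, not_not] at h6
          have h7 : e = e3 ∨ e = e5 := by tauto
          rcases h7 with rfl | rfl
          · rw [h3] at he; simp [huv, nu w hw] at he
          · rw [h5] at he; simp [huv, nu b hb] at he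
        · rintro (rfl | rfl | rfl)
          · simp [h1]
          · simp [h2']
          · simp [h4]
      · ext e
        simp only [Set.mem_ofPred_eq, Set.mem_insert_iff, Set.mem_singleton_iff]
        constructor
        · intro he
          by_contra hne
          have h6 : e ∉ R := fun h' => hv (hRi e h' v he)
          rw [hmR] at h6
          simp only [Set.mem_insert_iff, Set.mem_singleton_iff, not_not] at h6
          have h7 : e = e2 ∨ e = e4 := by tauto
          rcases h7 with rfl | rfl
          · rw [h2'] at he; simp [huv.symm, nv w hw] at he
          · rw [h4] at he; simp [huv.symm, nv a ha] at he
        · rintro (rfl | rfl | rfl)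
          · simp [h1]
          · simp [h3]
          · simp [h5]
      · rw [p2]
        ext y
        simp only [Set.mem_ofPred_eq]
        constructor
        · intro hy; exact ⟨(nu y hy).symm, (nv y hy).symm⟩
        · rintro ⟨q1, q2⟩
          have := hall y
          tauto
    by_cases hab : a = b
    · let f : {e // e ∈ R} → Sym2 G.V := fun e => G.ends e.1
      have hf : ∀ e, ∀ y ∈ f e, y ∈ S0 := fun e => hRi e.1 e.2
      have hfl : ∀ e, ¬ (f e).IsDiag := fun e => G.loopless e.1
      have hMf : Finset.univ.val.map f = M0 := (map_subtype G.ends R).trans hM5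
      refine ⟨mkH S0 {e // e ∈ R} f hf hfl, hbull _ ?_,
        mkH_ok S0 _ f hf hfl hMf hT hsub hc' h2⟩
      refine ⟨(Subtype.val : S0 → G.V), Subtype.val_injective, Subtype.range_coe, fun _ => ?_,
        fun h => absurd hab h⟩
      refine ⟨(Subtype.val : {e // e ∈ R} → G.E), Subtype.val_injective, ?_, ?_⟩
      · exact Subtype.range_coe
      · intro e
        exact (mkH_spec S0 _ f hf hfl e).symm
    · let f : Option {e // e ∈ R} → Sym2 G.V := fun o => o.elim s(a,b) fun e => G.ends e.1
      have hf : ∀ e, ∀ y ∈ f e, y ∈ S0 := by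
        rintro (_ | e) y hy
        · have : y ∈ s(a,b) := hy
          simp only [Sym2.mem_iff] at this
          rcases this with rfl | rfl <;> assumption
        · exact hRi e.1 e.2 y hy
      have hfl : ∀ e, ¬ (f e).IsDiag := by
        rintro (_ | e)
        · change ¬ (s(a,b)).IsDiag
          simpa using hab
        · exact G.loopless e.1
      have hMf : Finset.univ.val.map f = s(a,b) ::ₘ M0 := by
        rw [← hM5, ← map_subtype G.ends R]
        exact map_option (fun e : {e // e ∈ R} => G.ends e.1) s(a,b)
      refine ⟨mkH S0 (Option {e // e ∈ R}) f hf hfl, hbull _ ?_,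
        mkH_ok S0 _ f hf hfl hMf hT (fun x hx => Multiset.mem_cons_of_mem (hsub x hx)) hc h2⟩
      refine ⟨(Subtype.val : S0 → G.V), Subtype.val_injective, Subtype.range_coe,
        fun h => absurd h hab, fun _ => ?_⟩
      refine ⟨(none : Option {e // e ∈ R}),
        (fun o : Option {e // e ∈ R} => o.elim e1 Subtype.val), ?_, ?_, ?_, ?_⟩
      · exact mkH_spec S0 _ f hf hfl none
      · rintro (_ | e) he (_ | e') he' hee
        · rfl
        · exact absurd rfl he
        · exact absurd rfl he'
        · exact congrArg some (Subtype.ext hee)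
      · ext e
        constructor
        · rintro ⟨_ | e, he, rfl⟩
          · exact absurd rfl he
          · exact e.2
        · intro he
          exact ⟨some ⟨e, he⟩, (Option.some_ne_none _ : some _ ≠ none), rfl⟩
      · rintro (_ | e) he
        · exact absurd rfl he
        · exact (mkH_spec S0 _ f hf hfl (some e)).symm

theorem final (G : Multigraph) (hG : G.HasSpanningTriangleTree) :
    ¬ G.Z3Connected ↔
      ((G.IsK3 ∨ G.IsK4) ∨
      (∃ (SA : Set G.V) (FA : Set G.E) (SB : Set G.V) (FB : Set G.E),
        G.IsTwoSum SA FA SB FB ∧ G.IsTriangleSub SA FA ∧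
        ¬ G.SubZ3Connected SB FB ∧ ∃ F' ⊆ FB, G.IsTriangleTree SB F') ∨
      (∃ H : Multigraph, G.IsBullGrowing H ∧ ¬ H.Z3Connected ∧
        H.HasSpanningTriangleTree)) := by
  constructor
  · intro hz
    obtain ⟨F, hF⟩ := hG
    have hn := two_lt G hF
    obtain ⟨F', hT, -, hsub⟩ := tree_tt G hF
    have hle : F' ≤ G.em := (Multiset.le_iff_subset hT.nodup).2 hsub
    rw [z3_iff] at hz
    unfold Conn at hz
    push Not at hz
    obtain ⟨β, -, h2, hR⟩ := hz
    rcases BG.main hT hle G.em_ll h2 hR hn with h | h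
    · rcases out2_case G h with h | h
      · exact Or.inl (Or.inl h)
      · exact Or.inr (Or.inl h)
    · rcases out3_case G h with h | h
      · exact Or.inl (Or.inr h)
      · exact Or.inr (Or.inr h)
  · rintro ((h | h) | ⟨SA, FA, SB, FB, h1, h2, h3, -⟩ | ⟨H, h1, h2, -⟩)
    · exact k3_case G h
    · exact k4_case G h
    · exact fun hz => h3 (twosum_case G h1 h2 hz)
    · exact fun hz => h2 (bull_back G H h1 hz)

end Multigraph


/-- Let `G` have a spanning triangle-tree. Then `G` is not
`Z3`-connected iff (i) `G` is `K3` or `K4`, or (ii) `G = K3 ⊕₂ G1` with `G1` not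
`Z3`-connected and containing a spanning triangle-tree, or (iii) `G` is a bull-growing
of a graph `H` that is not `Z3`-connected and contains a spanning triangle-tree. -/
theorem stmt_3 (G : Multigraph) (hG : G.HasSpanningTriangleTree) :
    ¬ G.Z3Connected ↔
      ((G.IsK3 ∨ G.IsK4) ∨
      (∃ (SA : Set G.V) (FA : Set G.E) (SB : Set G.V) (FB : Set G.E),
        G.IsTwoSum SA FA SB FB ∧ G.IsTriangleSub SA FA ∧
        ¬ G.SubZ3Connected SB FB ∧ ∃ F' ⊆ FB, G.IsTriangleTree SB F') ∨
      (∃ H : Multigraph, G.IsBullGrowing H ∧ ¬ H.Z3Connected ∧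
        H.HasSpanningTriangleTree)) := by
  exact G.final hG
end

section
/- A crystal has no nowhere-zero 3-flow if and only if every vertex of the crystal has odd degree. -/
open scoped Classical

namespace CrystalProof

open Multigraph

inductive T2 (G : Multigraph) : Set G.V → Set G.E → Prop
  | base (a b : G.V) (e : G.E) (h : G.ends e = s(a, b)) : T2 G {a, b} {e}
  | grow (S : Set G.V) (F : Set G.E) (hT : T2 G S F)
      (v a b : G.V) (hv : v ∉ S) (e : G.E) (he : e ∈ F) (hab : G.ends e = s(a, b))
      (e1 e2 : G.E) (h1 : G.ends e1 = s(v, a)) (h2 : G.ends e2 = s(v, b)) :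
      T2 G (insert v S) (insert e1 (insert e2 F))

variable {G : Multigraph}

lemma ends_ne {e : G.E} {a b : G.V} (h : G.ends e = s(a, b)) : a ≠ b := by
  have := G.loopless e
  rw [h] at this
  simpa using this

lemma of_triangleTree {S : Set G.V} {F : Set G.E} (h : G.IsTriangleTree S F) : T2 G S F := by
  induction h with
  | base x y z e1 e2 e3 hxy hxz hyz h1 h2 h3 =>
    have := T2.grow _ _ (T2.base x y e1 h1) z x y (by simp; tauto) e1 (by simp) h1 e3 e2
      (by rw [h3, Sym2.eq_swap]) (by rw [h2, Sym2.eq_swap])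
    convert this using 1
    · ext; simp; tauto
    · ext; simp; tauto
  | grow S F hT v a b hv e he hab e1 e2 h1 h2 ih =>
    exact T2.grow S F ih v a b hv e he hab e1 e2 h1 h2

lemma T2.sub {S : Set G.V} {F : Set G.E} (h : T2 G S F) :
    ∀ e ∈ F, ∀ v, v ∈ G.ends e → v ∈ S := by
  induction h with
  | base a b e h =>
    intro e' he' v hv
    rw [Set.mem_singleton_iff] at he'
    subst he'
    rw [h] at hv
    simpa using hv
  | grow S F hT v a b hv e he hab e1 e2 h1 h2 ih =>
    have ha : a ∈ S := ih e he a (by simp [hab])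
    have hb : b ∈ S := ih e he b (by simp [hab])
    intro e' he' x hx
    simp only [Set.mem_insert_iff] at he' ⊢
    rcases he' with rfl | rfl | h
    · rw [h1] at hx; simp at hx; rcases hx with rfl | rfl <;> tauto
    · rw [h2] at hx; simp at hx; rcases hx with rfl | rfl <;> tauto
    · exact Or.inr (ih e' h x hx)

lemma deg_insert {F : Set G.E} {e : G.E} (he : e ∉ F) {a b : G.V} (h : G.ends e = s(a, b))
    (x : G.V) : G.degIn (insert e F) x = G.degIn F x + if x = a ∨ x = b then 1 else 0 := by
  unfold degIn
  split_ifs with hx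
  · have : {e' : G.E | e' ∈ insert e F ∧ x ∈ G.ends e'}
        = insert e {e' : G.E | e' ∈ F ∧ x ∈ G.ends e'} := by
      ext e'
      simp only [Set.mem_ofPred_eq, Set.mem_insert_iff]
      constructor
      · tauto
      · rintro (rfl | h')
        · simp [h, hx]
        · tauto
    rw [this, Set.ncard_insert_of_notMem (by simp [he]) (Set.toFinite _)]
  · congr 1
    ext e'
    simp only [Set.mem_ofPred_eq, Set.mem_insert_iff]
    constructor
    · rintro ⟨rfl | h', h''⟩
      · rw [h] at h''; simp at h''; tauto
      · tauto
    · tauto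

/-- Data of a growing step. -/
structure Gr (G : Multigraph) (S : Set G.V) (F : Set G.E) (S' : Set G.V) (F' : Set G.E)
    (v a b : G.V) (e e1 e2 : G.E) : Prop where
  t : T2 G S' F'
  hv : v ∉ S'
  he : e ∈ F'
  hab : G.ends e = s(a, b)
  h1 : G.ends e1 = s(v, a)
  h2 : G.ends e2 = s(v, b)
  hS : S = insert v S'
  hF : F = insert e1 (insert e2 F')

namespace Gr
variable {S S' : Set G.V} {F F' : Set G.E} {v a b : G.V} {e e1 e2 : G.E}

lemma symm (h : Gr G S F S' F' v a b e e1 e2) : Gr G S F S' F' v b a e e2 e1 :=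
  ⟨h.t, h.hv, h.he, by rw [h.hab, Sym2.eq_swap], h.h2, h.h1, h.hS, by
    rw [h.hF, Set.insert_comm]⟩

lemma ha (h : Gr G S F S' F' v a b e e1 e2) : a ∈ S' := h.t.sub e h.he a (by simp [h.hab])
lemma hb (h : Gr G S F S' F' v a b e e1 e2) : b ∈ S' := h.t.sub e h.he b (by simp [h.hab])
lemma va (h : Gr G S F S' F' v a b e e1 e2) : v ≠ a := ends_ne h.h1
lemma vb (h : Gr G S F S' F' v a b e e1 e2) : v ≠ b := ends_ne h.h2
lemma ab (h : Gr G S F S' F' v a b e e1 e2) : a ≠ b := ends_ne h.hab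
lemma n2 (h : Gr G S F S' F' v a b e e1 e2) : e2 ∉ F' := fun hh =>
  h.hv (h.t.sub e2 hh v (by simp [h.h2]))
lemma n1' (h : Gr G S F S' F' v a b e e1 e2) : e1 ∉ F' := fun hh =>
  h.hv (h.t.sub e1 hh v (by simp [h.h1]))
lemma ne12 (h : Gr G S F S' F' v a b e e1 e2) : e1 ≠ e2 := by
  rintro rfl
  have := h.h1.symm.trans h.h2
  rw [Sym2.congr_right] at this
  exact h.ab this
lemma n1 (h : Gr G S F S' F' v a b e e1 e2) : e1 ∉ insert e2 F' := by
  simp [h.ne12, h.n1']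

lemma deg (h : Gr G S F S' F' v a b e e1 e2) (x : G.V) :
    G.degIn F x = G.degIn F' x + (if x = v ∨ x = b then 1 else 0)
      + (if x = v ∨ x = a then 1 else 0) := by
  rw [h.hF, deg_insert h.n1 h.h1, deg_insert h.n2 h.h2]

lemma card (h : Gr G S F S' F' v a b e e1 e2) : S.ncard = S'.ncard + 1 := by
  rw [h.hS, Set.ncard_insert_of_notMem h.hv (Set.toFinite _)]

lemma deg0 (h : Gr G S F S' F' v a b e e1 e2) : G.degIn F' v = 0 := by
  unfold degIn
  convert Set.ncard_empty G.E
  ext e'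
  simp only [Set.mem_ofPred_eq, Set.mem_empty_iff_false, iff_false, not_and]
  exact fun h1 h2 => h.hv (h.t.sub e' h1 v h2)

lemma degv (h : Gr G S F S' F' v a b e e1 e2) : G.degIn F v = 2 := by
  rw [h.deg, h.deg0]; simp
lemma dega (h : Gr G S F S' F' v a b e e1 e2) : G.degIn F a = G.degIn F' a + 1 := by
  rw [h.deg]; simp [h.va.symm, h.ab]
lemma degb (h : Gr G S F S' F' v a b e e1 e2) : G.degIn F b = G.degIn F' b + 1 :=
  h.symm.dega
lemma dego (h : Gr G S F S' F' v a b e e1 e2) {x : G.V} (hv : x ≠ v) (ha : x ≠ a)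
    (hb : x ≠ b) : G.degIn F x = G.degIn F' x := by
  rw [h.deg]; simp [*]
lemma mem (h : Gr G S F S' F' v a b e e1 e2) {x : G.V} (hx : x ∈ S) (hv : x ≠ v) :
    x ∈ S' := by
  rw [h.hS] at hx; simpa [hv] using hx
lemma tree (h : Gr G S F S' F' v a b e e1 e2) : T2 G S F := by
  rw [h.hS, h.hF]
  exact T2.grow S' F' h.t v a b h.hv e h.he h.hab e1 e2 h.h1 h.h2
end Gr

lemma deg_single {e : G.E} {a b : G.V} (h : G.ends e = s(a, b)) (x : G.V) :
    G.degIn {e} x = if x = a ∨ x = b then 1 else 0 := by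
  have := deg_insert (F := ∅) (e := e) (by simp) h x
  rw [show (insert e ∅ : Set G.E) = {e} by simp] at this
  rw [this]; simp [degIn]

lemma T2.cases' {S : Set G.V} {F : Set G.E} (h : T2 G S F) :
    (∃ a b e, G.ends e = s(a, b) ∧ S = {a, b} ∧ F = {e}) ∨
    (∃ S' F' v a b e e1 e2, Gr G S F S' F' v a b e e1 e2) := by
  cases h with
  | base a b e h => exact Or.inl ⟨a, b, e, h, rfl, rfl⟩
  | grow S F hT v a b hv e he hab e1 e2 h1 h2 =>
    exact Or.inr ⟨S, F, v, a, b, e, e1, e2, hT, hv, he, hab, h1, h2, rfl, rfl⟩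

lemma T2.card2 {S : Set G.V} {F : Set G.E} (h : T2 G S F) : 2 ≤ S.ncard := by
  induction h with
  | base a b e h => rw [Set.ncard_pair (ends_ne h)]
  | grow S F hT v a b hv e he hab e1 e2 h1 h2 ih =>
    rw [Set.ncard_insert_of_notMem hv (Set.toFinite _)]; omega

lemma T2.card3 {S : Set G.V} {F : Set G.E} (h : T2 G S F) :
    (∃ a b e, G.ends e = s(a, b) ∧ S = {a, b} ∧ F = {e}) ∨ 3 ≤ S.ncard := by
  rcases h.cases' with h | ⟨S', F', v, a, b, e, e1, e2, h⟩
  · exact Or.inl h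
  · right; have := h.card; have := h.t.card2; omega

lemma T2.mindeg {S : Set G.V} {F : Set G.E} (h : T2 G S F) :
    3 ≤ S.ncard → ∀ x ∈ S, 2 ≤ G.degIn F x := by
  induction h with
  | base a b e h => rw [Set.ncard_pair (ends_ne h)]; omega
  | grow S F hT v a b hv e he hab e1 e2 h1 h2 ih =>
    intro _ x hx
    have g : Gr G (insert v S) _ S F v a b e e1 e2 := ⟨hT, hv, he, hab, h1, h2, rfl, rfl⟩
    by_cases hxv : x = v
    · subst hxv; exact g.degv.ge
    have hxS := g.mem hx hxv
    rcases hT.card3 with ⟨p, q, k, hk, rfl, rfl⟩ | h3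
    · have : e = k := he
      subst this
      rw [g.deg, deg_single hab]
      have : x = a ∨ x = b := by
        rw [hk] at hab
        have : x ∈ s(p, q) := by simpa using hxS
        rw [hab] at this; simpa using this
      rcases this with rfl | rfl <;> simp
    · have := ih h3 x hxS
      rw [g.deg]; omega

lemma T2.leafL {S : Set G.V} {F : Set G.E} (h : T2 G S F) :
    3 ≤ S.ncard → ∀ e ∈ F, ∃ y ∈ S, G.degIn F y = 2 ∧ y ∉ G.ends e := by
  induction h with
  | base a b e h => rw [Set.ncard_pair (ends_ne h)]; omega
  | grow S F hT v a b hv e he hab e1 e2 h1 h2 ih =>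
    intro _ e' he'
    have g : Gr G (insert v S) _ S F v a b e e1 e2 := ⟨hT, hv, he, hab, h1, h2, rfl, rfl⟩
    by_cases hve : v ∉ G.ends e'
    · exact ⟨v, by simp, g.degv, hve⟩
    push Not at hve
    rcases hT.card3 with ⟨p, q, k, hk, rfl, rfl⟩ | h3
    · have : e = k := he
      subst this
      have heF : ∀ x, x = a ∨ x = b → G.degIn (insert e1 (insert e2 {e})) x = 2 := by
        rintro x (rfl | rfl)
        · rw [g.dega, deg_single hab]; simp
        · rw [g.degb, deg_single hab]; simp
      rcases he' with rfl | rfl | h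
      · exact ⟨b, Or.inr g.hb, heF b (by simp), by rw [h1]; simp [g.ab.symm, g.vb.symm]⟩
      · exact ⟨a, Or.inr g.ha, heF a (by simp), by rw [h2]; simp [g.ab, g.va.symm]⟩
      · exact absurd (hT.sub e' h v hve) hv
    · obtain ⟨y, hy, hd, hn⟩ := ih h3 e he
      rw [hab] at hn
      simp only [Sym2.mem_iff, not_or] at hn
      have hyv : y ≠ v := fun h => hv (h ▸ hy)
      refine ⟨y, Or.inr hy, by rw [g.dego hyv hn.1 hn.2, hd], ?_⟩
      rcases he' with rfl | rfl | h
      · rw [h1]; simp [hyv, hn]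
      · rw [h2]; simp [hyv, hn]
      · exact absurd (hT.sub e' h v hve) hv

lemma T2.leaf_ne {S : Set G.V} {F : Set G.E} (h : T2 G S F) (h3 : 3 ≤ S.ncard) {u : G.V}
    (hu : u ∈ S) : ∃ y ∈ S, G.degIn F y = 2 ∧ y ≠ u := by
  have := h.mindeg h3 u hu
  have : {e : G.E | e ∈ F ∧ u ∈ G.ends e}.Nonempty := by
    rw [Set.nonempty_iff_ne_empty]
    intro h0
    unfold degIn at this
    rw [h0] at this
    simp at this
  obtain ⟨e, he, hue⟩ := this
  obtain ⟨y, hy, hd, hn⟩ := h.leafL h3 e he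
  exact ⟨y, hy, hd, fun h => hn (h ▸ hue)⟩

lemma T2.remove {S : Set G.V} {F : Set G.E} (h : T2 G S F) {v : G.V} :
    G.degIn F v = 2 → ∃ S' F' a b e e1 e2, Gr G S F S' F' v a b e e1 e2 := by
  induction h with
  | base a b e h =>
    rw [deg_single h]; intro h; split_ifs at h; omega
  | grow S F hT w a b hv e he hab e1 e2 h1 h2 ih =>
    intro hd
    have g : Gr G (insert w S) _ S F w a b e e1 e2 := ⟨hT, hv, he, hab, h1, h2, rfl, rfl⟩
    by_cases hvw : v = w
    · subst hvw; exact ⟨_, _, _, _, _, _, _, g⟩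
    rcases hT.card3 with ⟨p, q, k, hk, hS, hF⟩ | h3
    · subst hF
      have : e = k := he
      subst this
      have hS' : S = {a, b} := by
        rw [hab] at hk
        rw [hS]
        ext x
        have : x ∈ s(p, q) ↔ x ∈ s(a, b) := by rw [hk]
        simpa using this
      subst hS'
      have hvab : v = a ∨ v = b := by
        by_contra hc
        rw [g.deg, deg_single hab] at hd
        simp [hvw] at hd
        push Not at hc
        simp [hc] at hd
      rcases hvab with rfl | rfl
      · refine ⟨_, _, w, b, e2, e1, e, T2.base w b e2 h2, ?_, rfl, h2, by rw [h1, Sym2.eq_swap],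
          hab, ?_, ?_⟩
        · simp [hvw, g.ab]
        · ext x; simp; tauto
        · ext x; simp; tauto
      · refine ⟨_, _, w, a, e1, e2, e, T2.base w a e1 h1, ?_, rfl, h1, by rw [h2, Sym2.eq_swap],
          by rw [hab, Sym2.eq_swap], ?_, ?_⟩
        · simp [hvw, g.ab.symm]
        · ext x; simp; tauto
        · ext x; simp; tauto
    · have hva : v ≠ a := by
        rintro rfl
        have := hT.mindeg h3 v g.ha
        rw [g.dega] at hd; omega
      have hvb : v ≠ b := by
        rintro rfl
        have := hT.mindeg h3 v g.hb
        rw [g.degb] at hd; omega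
      rw [g.dego hvw hva hvb] at hd
      obtain ⟨S'', F'', p, q, k, k1, k2, g'⟩ := ih hd
      have he'' : e ∈ F'' := by
        have := he
        rw [g'.hF] at this
        rcases this with rfl | rfl | h
        · have := g'.h1; rw [hab] at this
          have : v ∈ s(a, b) := by rw [this]; simp
          simp [hva, hvb] at this
        · have := g'.h2; rw [hab] at this
          have : v ∈ s(a, b) := by rw [this]; simp
          simp [hva, hvb] at this
        · exact h
      have hw : w ∉ S'' := fun h => hv (by rw [g'.hS]; exact Or.inr h)
      refine ⟨_, _, p, q, k, k1, k2, T2.grow S'' F'' g'.t w a b hw e he'' hab e1 e2 h1 h2, ?_, ?_,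
        g'.hab, g'.h1, g'.h2, ?_, ?_⟩
      · simp [hvw, g'.hv]
      · exact Or.inr (Or.inr g'.he)
      · rw [g'.hS, Set.insert_comm]
      · rw [g'.hF]; ext x; simp; tauto

lemma T2.nonadj {S : Set G.V} {F : Set G.E} (h : T2 G S F) (h4 : 4 ≤ S.ncard) {x y : G.V}
    (hx : G.degIn F x = 2) (hy : G.degIn F y = 2) {k : G.E} (hk : k ∈ F)
    (hxy : G.ends k = s(x, y)) : False := by
  obtain ⟨S', F', a, b, e, e1, e2, g⟩ := h.remove hx
  have hne : x ≠ y := ends_ne hxy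
  have h3 : 3 ≤ S'.ncard := by have := g.card; omega
  have ha := g.t.mindeg h3 a g.ha
  have hb := g.t.mindeg h3 b g.hb
  rw [g.hF] at hk
  rcases hk with rfl | rfl | hk
  · have := hxy.symm.trans g.h1
    rw [Sym2.congr_right] at this
    subst this; rw [g.dega] at hy; omega
  · have := hxy.symm.trans g.h2
    rw [Sym2.congr_right] at this
    subst this; rw [g.degb] at hy; omega
  · exact g.hv (g.t.sub k hk x (by simp [hxy]))

/-! Flows mod 3 -/

noncomputable def dl (a : G.V) : G.V → ZMod 3 := fun x => if a = x then 1 else 0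

lemma dl_self (a : G.V) : dl a a = 1 := by simp [dl]
lemma dl_ne {a x : G.V} (h : a ≠ x) : dl a x = 0 := by simp [dl, h]

def Re (D : G.E → G.V × G.V) (F : Set G.E) (β : G.V → ZMod 3) : Prop :=
  ∃ f : G.E → ZMod 3, (∀ e, f e ≠ 0 ↔ e ∈ F) ∧
    ∀ x, ∑ e, f e * (dl (D e).1 x - dl (D e).2 x) = β x

variable {D : G.E → G.V × G.V}

lemma inc_or (hD : G.IsOrientation D) {e : G.E} {a b : G.V} (h : G.ends e = s(a, b)) :
    D e = (a, b) ∨ D e = (b, a) := by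
  have := (hD e).symm.trans h
  rw [Sym2.eq_iff] at this
  rcases this with h | h
  · left; ext <;> simp [h]
  · right; ext <;> simp [h]

lemma Re_insert0 {F : Set G.E} {e : G.E} (he : e ∉ F) (β : G.V → ZMod 3) :
    Re D (insert e F) β ↔
      ∃ x : ZMod 3, x ≠ 0 ∧ Re D F (β - x • (dl (D e).1 - dl (D e).2)) := by
  have key : ∀ (f : G.E → ZMod 3) (t : ZMod 3) (y : G.V),
      ∑ e', Function.update f e t e' * (dl (D e').1 y - dl (D e').2 y) =
      ∑ e', f e' * (dl (D e').1 y - dl (D e').2 y) + (t - f e) * (dl (D e).1 y - dl (D e).2 y) := by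
    intro f t y
    rw [← sub_eq_iff_eq_add', ← Finset.sum_sub_distrib, Finset.sum_eq_single e]
    · simp; ring
    · intro b _ hb; simp [Function.update_of_ne hb]
    · simp
  constructor
  · rintro ⟨f, hf, hb⟩
    refine ⟨f e, (hf e).2 (by simp), Function.update f e 0, ?_, ?_⟩
    · intro e'
      by_cases h : e' = e
      · subst h; simp [he]
      · rw [Function.update_of_ne h, hf]; simp [h]
    · intro y
      rw [key, hb]; simp; ring
  · rintro ⟨x, hx, f, hf, hb⟩
    refine ⟨Function.update f e x, ?_, ?_⟩
    · intro e'
      by_cases h : e' = e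
      · subst h; simp [hx]
      · rw [Function.update_of_ne h, hf]; simp [h]
    · intro y
      have : f e = 0 := by by_contra h; exact he ((hf e).1 h)
      rw [key, hb, this]; simp

lemma Re_insert (hD : G.IsOrientation D) {F : Set G.E} {e : G.E} (he : e ∉ F) {a b : G.V}
    (h : G.ends e = s(a, b)) (β : G.V → ZMod 3) :
    Re D (insert e F) β ↔ ∃ x : ZMod 3, x ≠ 0 ∧ Re D F (β - x • (dl a - dl b)) := by
  rw [Re_insert0 he]
  rcases inc_or hD h with h | h
  · rw [h]
  · rw [h]
    constructor
    · rintro ⟨x, hx, hr⟩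
      refine ⟨-x, by simpa using hx, ?_⟩
      convert hr using 1
      module
    · rintro ⟨x, hx, hr⟩
      refine ⟨-x, by simpa using hx, ?_⟩
      convert hr using 1
      module

lemma Re_neg {F : Set G.E} {β : G.V → ZMod 3} (h : Re D F β) : Re D F (-β) := by
  obtain ⟨f, hf, hb⟩ := h
  refine ⟨-f, by simpa using hf, fun x => ?_⟩
  simp only [Pi.neg_apply, ← hb, neg_mul, Finset.sum_neg_distrib]

lemma Re_supp (hD : G.IsOrientation D) {S : Set G.V} {F : Set G.E} {β : G.V → ZMod 3}
    (hs : ∀ e ∈ F, ∀ v, v ∈ G.ends e → v ∈ S) (h : Re D F β) {x : G.V} (hx : x ∉ S) :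
    β x = 0 := by
  obtain ⟨f, hf, hb⟩ := h
  rw [← hb]
  apply Finset.sum_eq_zero
  intro e _
  by_cases he : e ∈ F
  · have h1 : (D e).1 ≠ x := fun h => hx (hs e he x (by rw [hD e]; simp [h]))
    have h2 : (D e).2 ≠ x := fun h => hx (hs e he x (by rw [hD e]; simp [h]))
    rw [dl_ne h1, dl_ne h2]; simp
  · have : f e = 0 := by by_contra h; exact he ((hf e).1 h)
    simp [this]

lemma Re_empty : Re D ∅ 0 := ⟨0, by simp, by simp⟩

lemma z3sum (b : ZMod 3) : ∃ x y : ZMod 3, x ≠ 0 ∧ y ≠ 0 ∧ x + y = b := by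
  revert b; decide

lemma sum_dl (a : G.V) : ∑ x, dl a x = 1 := by simp [dl]

lemma Gr.Re {S S' : Set G.V} {F F' : Set G.E} {v a b : G.V} {e e1 e2 : G.E}
    (hD : G.IsOrientation D) (g : Gr G S F S' F' v a b e e1 e2) (β : G.V → ZMod 3) :
    Re D F β ↔ ∃ x y : ZMod 3, x ≠ 0 ∧ y ≠ 0 ∧
      Re D F' (β - x • (dl v - dl a) - y • (dl v - dl b)) := by
  rw [g.hF, Re_insert hD g.n1 g.h1]
  simp only [Re_insert hD g.n2 g.h2]
  constructor
  · rintro ⟨x, hx, y, hy, h⟩; exact ⟨x, y, hx, hy, h⟩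
  · rintro ⟨x, y, hx, hy, h⟩; exact ⟨x, hx, y, hy, h⟩

lemma T2.free (hD : G.IsOrientation D) {S : Set G.V} {F : Set G.E} (h : T2 G S F) :
    ∀ β : G.V → ZMod 3, (∀ x, x ∉ S → β x = 0) → ∑ x, β x = 0 → ∀ e ∈ F, ∀ a b : G.V,
      G.ends e = s(a, b) → ∃ z : ZMod 3, Re D (F \ {e}) (β - z • (dl a - dl b)) := by
  induction h with
  | base p q k hk =>
    intro β hs h0 e he a b hab
    have : e = k := he
    subst this
    have hne := ends_ne hab
    have hS : ∀ x, x ∈ ({p, q} : Set G.V) ↔ x = a ∨ x = b := by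
      intro x
      have : x ∈ s(p, q) ↔ x ∈ s(a, b) := by rw [← hk, hab]
      simpa using this
    simp only [hS] at hs
    refine ⟨β a, ?_⟩
    convert Re_empty using 1
    · simp
    · have hβ : ∀ x, β x = β a * dl a x + β b * dl b x := by
        intro x
        by_cases h1 : x = a
        · subst h1; rw [dl_self, dl_ne hne.symm]; ring
        by_cases h2 : x = b
        · subst h2; rw [dl_self, dl_ne hne]; ring
        rw [hs x (by tauto), dl_ne (Ne.symm h1), dl_ne (Ne.symm h2)]; ring
      have h0' : β a + β b = 0 := by
        rw [← h0, Finset.sum_congr rfl (fun x _ => hβ x), Finset.sum_add_distrib,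
          ← Finset.mul_sum, ← Finset.mul_sum, sum_dl, sum_dl]; ring
      ext x
      simp only [Pi.sub_apply, Pi.smul_apply, smul_eq_mul, Pi.zero_apply]
      rw [hβ x]
      linear_combination h0' * dl b x
  | grow S F hT v a b hv e he hab e1 e2 h1 h2 ih =>
    have g : Gr G (insert v S) _ S F v a b e e1 e2 := ⟨hT, hv, he, hab, h1, h2, rfl, rfl⟩
    intro β hs h0
    have main : ∀ (a b : G.V) (e1 e2 : G.E), Gr G (insert v S) (insert e1 (insert e2 F)) S F v a b e e1 e2 →
        ∃ z : ZMod 3, Re D (insert e2 F) (β - z • (dl v - dl a)) := by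
      clear g hab h1 h2 e1 e2 a b
      intro a b e1 e2 g
      obtain ⟨z, hz⟩ := ih (β - β v • (dl v - dl a)) (by
        intro x hx
        simp only [Pi.sub_apply, Pi.smul_apply, smul_eq_mul]
        rw [dl_ne (a := a) (x := x) (fun h => hx (h ▸ g.ha))]
        by_cases hxv : x = v
        · subst hxv; rw [dl_self]; ring
        · rw [dl_ne (Ne.symm hxv), hs x (by simp [hxv, hx])]; ring) (by
        simp only [Pi.sub_apply, Pi.smul_apply, smul_eq_mul, Finset.sum_sub_distrib,
          ← Finset.mul_sum, sum_dl, h0]; ring) e he a b g.hab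
      obtain ⟨y, w, hy, hw, hyw⟩ := z3sum z
      refine ⟨β v - y, ?_⟩
      rw [Re_insert hD g.n2 g.h2]
      refine ⟨y, hy, ?_⟩
      rw [← Set.insert_sdiff_self_of_mem he, Re_insert hD (by simp) g.hab]
      refine ⟨w, hw, ?_⟩
      convert hz using 1
      rw [← hyw]
      module
    intro e' he' p q hpq
    rcases he' with rfl | rfl | he'
    · obtain ⟨z, hz⟩ := main a b e' e2 g
      rw [Set.insert_sdiff_of_mem _ (by simp), Set.sdiff_singleton_eq_self g.n1]
      rcases Sym2.eq_iff.1 (hpq.symm.trans h1) with ⟨rfl, rfl⟩ | ⟨rfl, rfl⟩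
      · exact ⟨z, hz⟩
      · refine ⟨-z, ?_⟩
        convert hz using 1; module
    · obtain ⟨z, hz⟩ := main b a e' e1 (by have := g.symm; rwa [Set.insert_comm] at this)
      rw [Set.insert_comm, Set.insert_sdiff_of_mem _ (by simp), Set.sdiff_singleton_eq_self g.symm.n1]
      rcases Sym2.eq_iff.1 (hpq.symm.trans h2) with ⟨rfl, rfl⟩ | ⟨rfl, rfl⟩
      · exact ⟨z, hz⟩
      · refine ⟨-z, ?_⟩
        convert hz using 1; module
    · obtain ⟨x, y, hx, hy, hxy⟩ := z3sum (β v)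
      obtain ⟨z, hz⟩ := ih (β - x • (dl v - dl a) - y • (dl v - dl b)) (by
        intro t ht
        simp only [Pi.sub_apply, Pi.smul_apply, smul_eq_mul]
        rw [dl_ne (a := a) (x := t) (fun h => ht (h ▸ g.ha)),
          dl_ne (a := b) (x := t) (fun h => ht (h ▸ g.hb))]
        by_cases hxv : t = v
        · subst hxv; rw [dl_self, ← hxy]; ring
        · rw [dl_ne (Ne.symm hxv), hs t (by simp [hxv, ht])]; ring) (by
        simp only [Pi.sub_apply, Pi.smul_apply, smul_eq_mul, Finset.sum_sub_distrib,
          ← Finset.mul_sum, sum_dl, h0]; ring) e' he' p q hpq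
      refine ⟨z, ?_⟩
      have n1 : e1 ≠ e' := fun h => g.n1' (h ▸ he')
      have n2 : e2 ≠ e' := fun h => g.n2 (h ▸ he')
      rw [Set.insert_sdiff_of_notMem _ (by simpa using n1), Set.insert_sdiff_of_notMem _ (by simpa using n2),
        Re_insert hD (by simp [g.ne12, g.n1']) h1]
      refine ⟨x, hx, ?_⟩
      rw [Re_insert hD (by simp [g.n2]) h2]
      refine ⟨y, hy, ?_⟩
      convert hz using 1
      module

/-! From flows mod 3 to integer flows -/

noncomputable def dz (a : G.V) : G.V → ℤ := fun x => if a = x then 1 else 0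

noncomputable def bdZ (D : G.E → G.V × G.V) (f : G.E → ℤ) (x : G.V) : ℤ :=
  ∑ e, f e * (dz (D e).1 x - dz (D e).2 x)

def Arc (D : G.E → G.V × G.V) (f : G.E → ℤ) (e : G.E) (x y : G.V) : Prop :=
  (0 < f e ∧ D e = (x, y)) ∨ (f e < 0 ∧ D e = (y, x))

def Good (D : G.E → G.V × G.V) (f : G.E → ℤ) : Prop :=
  (∀ e, 1 ≤ |f e| ∧ |f e| ≤ 2) ∧ ∀ x, 3 ∣ bdZ D f x

noncomputable def flipE (f : G.E → ℤ) (e : G.E) : G.E → ℤ :=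
  Function.update f e (if 0 < f e then f e - 3 else f e + 3)

noncomputable def Phi (D : G.E → G.V × G.V) (f : G.E → ℤ) : ℕ := ∑ x, (bdZ D f x).natAbs

lemma flip_bd {f : G.E → ℤ} {e : G.E} {x y : G.V} (h : Arc D f e x y) (z : G.V) :
    bdZ D (flipE f e) z = bdZ D f z - 3 * (dz x z - dz y z) := by
  have key : ∀ t : ℤ,
      ∑ e', Function.update f e t e' * (dz (D e').1 z - dz (D e').2 z) =
      ∑ e', f e' * (dz (D e').1 z - dz (D e').2 z) + (t - f e) * (dz (D e).1 z - dz (D e).2 z) := by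
    intro t
    rw [← sub_eq_iff_eq_add', ← Finset.sum_sub_distrib, Finset.sum_eq_single e]
    · simp; ring
    · intro b _ hb; simp [Function.update_of_ne hb]
    · simp
  unfold bdZ flipE
  rw [key]
  rcases h with ⟨h, h'⟩ | ⟨h, h'⟩
  · rw [if_pos h, h']; ring
  · rw [if_neg (by omega), h']; ring

lemma flip_good {f : G.E → ℤ} (hf : Good D f) {e : G.E} {x y : G.V} (h : Arc D f e x y) :
    Good D (flipE f e) := by
  constructor
  · intro e'
    by_cases he : e' = e
    · subst he
      have := hf.1 e'
      simp only [flipE, Function.update_self]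
      grind
    · simp only [flipE, Function.update_of_ne he]
      exact hf.1 e'
  · intro z
    rw [flip_bd h]
    exact dvd_sub (hf.2 z) (dvd_mul_right _ _)

inductive Trail (D : G.E → G.V × G.V) (f : G.E → ℤ) (s : G.V) : G.V → Set G.E → Prop
  | nil : Trail D f s s ∅
  | snoc (y t : G.V) (L : Set G.E) (e : G.E) (h : Trail D f s y L) (he : e ∉ L)
      (ha : Arc D f e y t) : Trail D f s t (insert e L)

lemma Trail.initial {f : G.E → ℤ} {s t : G.V} {L : Set G.E} (h : Trail D f s t L) :
    ∀ e ∈ L, ∀ y z, Arc D f e y z → ∃ L', Trail D f s z L' := by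
  induction h with
  | nil => intro e he; exact absurd he (by simp)
  | snoc y t L e h he ha ih =>
    intro e' he' y' z harc
    rcases he' with rfl | he'
    · have : z = t := by
        rcases ha with ⟨h1, h2⟩ | ⟨h1, h2⟩ <;> rcases harc with ⟨h3, h4⟩ | ⟨h3, h4⟩
        · rw [h2] at h4; simp_all
        · omega
        · omega
        · rw [h2] at h4; simp_all
      subst this
      exact ⟨_, Trail.snoc y z L e' h he ha⟩
    · exact ih e' he' y' z harc

lemma sum_two (h : G.V → ℕ) {y t : G.V} (hyt : y ≠ t) :
    ∑ z, h z = h y + (h t + ∑ z ∈ (Finset.univ.erase y).erase t, h z) := by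
  rw [Finset.add_sum_erase _ _ (by simp [hyt.symm]), Finset.add_sum_erase _ _ (by simp)]

lemma no_trail (hD : G.IsOrientation D) {f : G.E → ℤ} {s t : G.V} {L : Set G.E}
    (h : Trail D f s t L) :
    ∀ f' : G.E → ℤ, (∀ e ∈ L, f' e = f e) → Good D f' →
      (∀ f'', Good D f'' → Phi D f' ≤ Phi D f'') → 0 < bdZ D f' s → bdZ D f' t < 0 → False := by
  induction h with
  | nil => intro f' _ _ _ h1 h2; omega
  | snoc y t L e h he ha ih =>
    intro f' hL hg hm hs ht
    have harc : Arc D f' e y t := by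
      unfold Arc at ha ⊢
      rw [hL e (by simp)]; exact ha
    have hyt : y ≠ t := by
      have := G.loopless e
      rw [hD e] at this
      rcases ha with ⟨_, h2⟩ | ⟨_, h2⟩ <;> rw [h2] at this <;> simp at this
      · exact this
      · exact Ne.symm this
    have hg' := flip_good hg harc
    have hby : bdZ D (flipE f' e) y = bdZ D f' y - 3 := by
      rw [flip_bd harc]; simp [dz, hyt.symm]
    have hbt : bdZ D (flipE f' e) t = bdZ D f' t + 3 := by
      rw [flip_bd harc]; simp [dz, hyt]
    have hbo : ∀ z, z ≠ y → z ≠ t → bdZ D (flipE f' e) z = bdZ D f' z := by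
      intro z h1 h2
      rw [flip_bd harc]; simp [dz, h1.symm, h2.symm]
    have hrest : ∑ z ∈ (Finset.univ.erase y).erase t, (bdZ D (flipE f' e) z).natAbs
        = ∑ z ∈ (Finset.univ.erase y).erase t, (bdZ D f' z).natAbs := by
      apply Finset.sum_congr rfl
      intro z hz
      simp at hz
      rw [hbo z hz.2 hz.1]
    have e1 : Phi D f' = _ := sum_two (fun z => (bdZ D f' z).natAbs) hyt
    have e2 : Phi D (flipE f' e) = _ := sum_two (fun z => (bdZ D (flipE f' e) z).natAbs) hyt
    beta_reduce at e1 e2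
    rw [hrest, hby, hbt] at e2
    have dt := hg.2 t
    have dy := hg.2 y
    have hle := hm _ hg'
    by_cases hy : 0 < bdZ D f' y
    · omega
    have heq : Phi D (flipE f' e) = Phi D f' := by omega
    have hsy : s ≠ y := by rintro rfl; omega
    have hst : s ≠ t := by rintro rfl; omega
    apply ih (flipE f' e) _ hg' _ _ _
    · intro e' he'
      have : e' ≠ e := by rintro rfl; exact he he'
      simp only [flipE, Function.update_of_ne this]
      exact hL e' (Or.inr he')
    · rw [heq]; exact hm
    · rw [hbo s hsy hst]; exact hs
    · omega

lemma sum_bdZ (f : G.E → ℤ) (R : Set G.V) :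
    ∑ x, (if x ∈ R then bdZ D f x else 0) =
      ∑ e, f e * ((if (D e).1 ∈ R then 1 else 0) - (if (D e).2 ∈ R then 1 else 0)) := by
  have h1 : ∀ x, (if x ∈ R then bdZ D f x else 0) =
      ∑ e, if x ∈ R then f e * (dz (D e).1 x - dz (D e).2 x) else 0 := by
    intro x
    split_ifs
    · rfl
    · simp
  rw [Finset.sum_congr rfl (fun x _ => h1 x), Finset.sum_comm]
  apply Finset.sum_congr rfl
  intro e _
  have h2 : ∀ a : G.V, (if a ∈ R then (1 : ℤ) else 0) = ∑ x, if x ∈ R then dz a x else 0 := by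
    intro a
    rw [Finset.sum_eq_single a]
    · simp [dz]
    · intro b _ hb; simp [dz, hb.symm]
    · simp
  rw [h2, h2, ← Finset.sum_sub_distrib, Finset.mul_sum]
  apply Finset.sum_congr rfl
  intro x _
  split_ifs <;> simp

lemma bdZ_zero_of_min (hD : G.IsOrientation D) {f : G.E → ℤ} (hg : Good D f)
    (hm : ∀ f', Good D f' → Phi D f ≤ Phi D f') : ∀ x, bdZ D f x = 0 := by
  have hnp : ∀ s, ¬ 0 < bdZ D f s := by
    intro s hs
    obtain ⟨R, hRm⟩ : ∃ R : Set G.V, ∀ t, t ∈ R ↔ ∃ L, Trail D f s t L :=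
      ⟨{t | ∃ L, Trail D f s t L}, fun _ => Iff.rfl⟩
    have hR : ∀ t ∈ R, 0 ≤ bdZ D f t := by
      intro t ht
      obtain ⟨L, hL⟩ := (hRm t).1 ht
      by_contra hc
      exact no_trail hD hL f (fun _ _ => rfl) hg hm hs (by omega)
    have hsR : s ∈ R := (hRm s).2 ⟨∅, Trail.nil⟩
    have hclosed : ∀ e y z, Arc D f e y z → y ∈ R → z ∈ R := by
      intro e y z ha hy
      rw [hRm] at hy ⊢
      obtain ⟨L, hL⟩ := hy
      by_cases he : e ∈ L
      · exact hL.initial e he y z ha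
      · exact ⟨_, Trail.snoc y z L e hL he ha⟩
    have h1 : 0 < ∑ x, (if x ∈ R then bdZ D f x else 0) := by
      apply Finset.sum_pos'
      · intro x _
        split_ifs with h
        · exact hR x h
        · exact le_rfl
      · exact ⟨s, by simp, by simpa [hsR] using hs⟩
    rw [sum_bdZ] at h1
    have h2 : ∑ e, f e * ((if (D e).1 ∈ R then 1 else 0) - (if (D e).2 ∈ R then 1 else 0)) ≤ 0 := by
      apply Finset.sum_nonpos
      intro e _
      have hfe := (hg.1 e).1
      rcases lt_trichotomy (f e) 0 with h | h | h
      · have := hclosed e (D e).2 (D e).1 (Or.inr ⟨h, rfl⟩)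
        by_cases h1 : (D e).1 ∈ R <;> by_cases h2 : (D e).2 ∈ R <;> simp [h1, h2]
        · omega
        · exact absurd (this h2) h1
      · rw [h] at hfe; simp at hfe
      · have := hclosed e (D e).1 (D e).2 (Or.inl ⟨h, rfl⟩)
        by_cases h1 : (D e).1 ∈ R <;> by_cases h2 : (D e).2 ∈ R <;> simp [h1, h2]
        · exact absurd (this h1) h2
        · omega
    omega
  have h0 : ∑ x, bdZ D f x = 0 := by
    have := sum_bdZ (D := D) f Set.univ
    simpa using this
  intro x
  have := (Finset.sum_eq_zero_iff_of_nonpos (fun x _ => not_lt.1 (hnp x))).1 h0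
  exact this x (by simp)

lemma conserving_iff (f : G.E → ℤ) : G.IsConserving D f ↔ ∀ x, bdZ D f x = 0 := by
  unfold IsConserving
  apply forall_congr'
  intro x
  rw [← sub_eq_zero, ← Finset.sum_sub_distrib]
  unfold bdZ
  have : ∀ e, f e * (dz (D e).1 x - dz (D e).2 x) =
      (if (D e).1 = x then f e else 0) - (if (D e).2 = x then f e else 0) := by
    intro e
    simp only [dz]
    split_ifs <;> simp
  simp only [this]

lemma cast_bdZ (f : G.E → ℤ) (x : G.V) :
    ((bdZ D f x : ℤ) : ZMod 3) = ∑ e, (f e : ZMod 3) * (dl (D e).1 x - dl (D e).2 x) := by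
  unfold bdZ
  push_cast
  apply Finset.sum_congr rfl
  intro e _
  simp [dz, dl]

lemma Re_of_flow {f : G.E → ℤ} (h1 : ∀ e, 1 ≤ |f e| ∧ |f e| ≤ 2)
    (h2 : G.IsConserving D f) : Re D Set.univ 0 := by
  rw [conserving_iff] at h2
  refine ⟨fun e => (f e : ZMod 3), ?_, ?_⟩
  · intro e
    simp only [Set.mem_univ, iff_true, ne_eq]
    rw [ZMod.intCast_zmod_eq_zero_iff_dvd]
    have := h1 e
    grind
  · intro x
    rw [← cast_bdZ, h2 x]; simp

lemma flow_of_Re (hD : G.IsOrientation D) (h : Re D Set.univ 0) : G.HasNZ3Flow := by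
  obtain ⟨g, hg, hb⟩ := h
  have hex : ∃ n, ∃ f, Good D f ∧ Phi D f = n := by
    refine ⟨_, fun e => ((g e).val : ℤ), ⟨?_, ?_⟩, rfl⟩
    · intro e
      have h1 : g e ≠ 0 := (hg e).2 (by simp)
      have h2 := ZMod.val_lt (g e)
      have h3 : (g e).val ≠ 0 := by rwa [ne_eq, ZMod.val_eq_zero]
      show 1 ≤ |((g e).val : ℤ)| ∧ |((g e).val : ℤ)| ≤ 2
      rw [abs_of_nonneg (by positivity)]
      omega
    · intro x
      have : ((bdZ D (fun e => ((g e).val : ℤ)) x : ℤ) : ZMod 3) = 0 := by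
        rw [cast_bdZ]
        simpa using hb x
      exact (ZMod.intCast_zmod_eq_zero_iff_dvd _ 3).1 this
  obtain ⟨f, hf, hn⟩ := Nat.find_spec hex
  refine ⟨D, f, hD, hf.1, ?_⟩
  rw [conserving_iff]
  apply bdZ_zero_of_min hD hf
  intro f' hf'
  rw [hn]
  exact Nat.find_min' hex ⟨f', hf', rfl⟩

lemma exists_orientation (G : Multigraph) : ∃ D, G.IsOrientation D := by
  have : ∀ e, ∃ p : G.V × G.V, G.ends e = s(p.1, p.2) := by
    intro e
    induction h : G.ends e with | _ a b => exact ⟨(a, b), rfl⟩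
  choose D hD using this
  exact ⟨D, hD⟩

/-! The main induction -/

lemma z3a : ∀ x y : ZMod 3, x ≠ 0 → y ≠ 0 → -1 - x - y = 0 → x = 1 ∧ y = 1 := by decide
lemma z3b : ∀ z w : ZMod 3, z ≠ 0 → w ≠ 0 → 1 - z - w = 0 → z = -1 ∧ w = -1 := by decide

/-- Removing two end vertices. -/
lemma reduce (hD : G.IsOrientation D) {S S1 S2 : Set G.V} {F F1 F2 : Set G.E}
    {u v a b c : G.V} {e e1 e2 k k1 k2 : G.E}
    (g : Gr G S F S1 F1 v a b e e1 e2) (g' : Gr G S1 F1 S2 F2 a b c k k1 k2)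
    (huv : u ≠ v) (hua : u ≠ a) :
    Re D F (dl u - dl v) ↔ Re D F2 (dl u - dl c) := by
  have hcv : c ≠ v := by
    rintro rfl
    exact g.hv (by rw [g'.hS]; exact Or.inr g'.hb)
  have hv2 : v ∉ S2 := fun h => g.hv (by rw [g'.hS]; exact Or.inr h)
  have hid : (dl u - dl v - (1 : ZMod 3) • (dl v - dl a) - (1 : ZMod 3) • (dl v - dl b))
      - (-1 : ZMod 3) • (dl a - dl b) - (-1 : ZMod 3) • (dl a - dl c) = dl u - dl c := by
    ext t
    simp only [Pi.sub_apply, Pi.smul_apply, smul_eq_mul]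
    have h3 : (3 : ZMod 3) = 0 := rfl
    linear_combination (dl a t - dl v t) * h3
  rw [g.Re hD]
  simp only [g'.Re hD]
  constructor
  · rintro ⟨x, y, hx, hy, z, w, hz, hw, h⟩
    have h1 := Re_supp hD g'.t.sub h hv2
    have h2 := Re_supp hD g'.t.sub h g'.hv
    simp only [Pi.sub_apply, Pi.smul_apply, smul_eq_mul, dl_self, dl_ne huv, dl_ne g.va.symm,
      dl_ne g.vb.symm, dl_ne hcv, dl_ne hua, dl_ne g.va, dl_ne g'.va.symm, dl_ne g'.vb.symm]
      at h1 h2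
    obtain ⟨rfl, rfl⟩ := z3a x y hx hy (by linear_combination h1)
    obtain ⟨rfl, rfl⟩ := z3b z w hz hw (by linear_combination h2)
    rwa [hid] at h
  · intro h
    refine ⟨1, 1, by decide, by decide, -1, -1, by decide, by decide, ?_⟩
    rwa [hid]

lemma main (hD : G.IsOrientation D) (u : G.V) : ∀ (n : ℕ) (S : Set G.V) (F : Set G.E) (v : G.V),
    S.ncard = n → T2 G S F → u ∈ S → u ≠ v → G.degIn F u = 2 → G.degIn F v = 2 →
    (S.ncard = 3 ∨ ∀ x ∈ S, G.degIn F x = 2 → x = u ∨ x = v) →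
    (Re D F (dl u - dl v) ↔ ∃ x ∈ S, x ≠ u ∧ x ≠ v ∧ Even (G.degIn F x)) := by
  intro n
  induction n using Nat.strong_induction_on with
  | _ n IH =>
  intro S F v hn hT huS huv hdu hdv hleaf
  obtain ⟨S1, F1, a, b, e, e1, e2, g⟩ := hT.remove hdv
  have hu1 : u ∈ S1 := g.mem huS huv
  rcases g.t.card3 with ⟨p, q, k, hk, hS1, rfl⟩ | h3
  · skip
    have hek : e = k := g.he
    subst hek
    have hS1' : ∀ x, x ∈ S1 ↔ x = a ∨ x = b := by
      intro x
      have : x ∈ s(p, q) ↔ x ∈ s(a, b) := by rw [← hk, g.hab]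
      rw [hS1]
      simpa using this
    have tri : ∀ (a b : G.V) (e1 e2 : G.E), Gr G S F S1 {e} v a b e e1 e2 → u = a →
        (Re D F (dl u - dl v) ∧ ∃ x ∈ S, x ≠ u ∧ x ≠ v ∧ Even (G.degIn F x)) := by
      rintro a b e1 e2 g rfl
      constructor
      · rw [g.Re hD]
        refine ⟨1, 1, by decide, by decide, ?_⟩
        rw [show ({e} : Set G.E) = insert e ∅ by simp, Re_insert hD (by simp) g.hab]
        refine ⟨-1, by decide, ?_⟩
        convert Re_empty using 1
        ext t
        simp only [Pi.sub_apply, Pi.smul_apply, smul_eq_mul, Pi.zero_apply]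
        have h3 : (3 : ZMod 3) = 0 := rfl
        linear_combination (dl u t - dl v t) * h3
      · refine ⟨b, by rw [g.hS]; exact Or.inr g.hb, g.ab.symm, g.vb.symm, ?_⟩
        rw [g.degb, deg_single g.hab]
        simp
    have : Re D F (dl u - dl v) ∧ ∃ x ∈ S, x ≠ u ∧ x ≠ v ∧ Even (G.degIn F x) := by
      rcases (hS1' u).1 hu1 with h | h
      · exact tri a b e1 e2 g h
      · exact tri b a e2 e1 g.symm h
    exact iff_of_true this.1 this.2
  have hcard := g.card
  have hleaf : ∀ x ∈ S, G.degIn F x = 2 → x = u ∨ x = v := by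
    rcases hleaf with h | h
    · omega
    · exact h
  have hmin := g.t.mindeg h3
  obtain ⟨y, hy, hdy, hyu⟩ := g.t.leaf_ne h3 hu1
  have hyv : y ≠ v := fun h => g.hv (h ▸ hy)
  have hyS : y ∈ S := by rw [g.hS]; exact Or.inr hy
  have hyab : y = a ∨ y = b := by
    by_contra hc
    push Not at hc
    have := hleaf y hyS (by rw [g.dego hyv hc.1 hc.2, hdy])
    tauto
  obtain ⟨a, b, e1, e2, g, hda⟩ : ∃ a b e1 e2, Gr G S F S1 F1 v a b e e1 e2 ∧
      G.degIn F1 a = 2 := by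
    rcases hyab with rfl | rfl
    · exact ⟨_, _, _, _, g, hdy⟩
    · exact ⟨_, _, _, _, g.symm, hdy⟩
  clear hyab hyS hyv hdy hyu hy y
  have hua : u ≠ a := by
    rintro rfl
    have := hmin u hu1
    rw [g.dega] at hdu; omega
  have hub : u ≠ b := by
    rintro rfl
    have := hmin u hu1
    rw [g.degb] at hdu; omega
  have hdu1 : G.degIn F1 u = 2 := by rw [← g.dego huv hua hub, hdu]
  obtain ⟨S2, F2, p, q, k, k1, k2, g'⟩ := g.t.remove hda
  obtain ⟨c, k1, k2, g'⟩ : ∃ c k1 k2, Gr G S1 F1 S2 F2 a b c k k1 k2 := by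
    have he := g.he
    rw [g'.hF] at he
    rcases he with rfl | rfl | he
    · have := g'.h1.symm.trans g.hab
      rw [Sym2.congr_right] at this
      subst this
      exact ⟨_, _, _, g'⟩
    · have := g'.h2.symm.trans g.hab
      rw [Sym2.congr_right] at this
      subst this
      exact ⟨_, _, _, g'.symm⟩
    · exact absurd (g'.t.sub e he a (by simp [g.hab])) g'.hv
  rw [reduce hD g g' huv hua]
  have hu2 : u ∈ S2 := g'.mem hu1 hua
  have hcard' := g'.card
  have hcS1 : c ∈ S1 := by rw [g'.hS]; exact Or.inr g'.hb
  have hcv : c ≠ v := fun h => g.hv (h ▸ hcS1)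
  have hv2 : v ∉ S2 := fun h => g.hv (by rw [g'.hS]; exact Or.inr h)
  have sub2 : ∀ x ∈ S2, x ∈ S := fun x hx => by
    rw [g.hS, g'.hS]; exact Or.inr (Or.inr hx)
  have dA : G.degIn F a = 3 := by rw [g.dega, hda]
  have dB : G.degIn F b = G.degIn F2 b + 2 := by rw [g.degb, g'.dega]
  have dC : G.degIn F c = G.degIn F2 c + 1 := by
    rw [g.dego hcv g'.vb.symm g'.ab.symm, g'.degb]
  have dO : ∀ x, x ≠ v → x ≠ a → x ≠ b → x ≠ c → G.degIn F x = G.degIn F2 x := by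
    intro x h1 h2 h3 h4
    rw [g.dego h1 h2 h3, g'.dego h2 h3 h4]
  rcases g'.t.card3 with ⟨p, q, k', hk, hS2, rfl⟩ | h3'
  · skip
    have hek : k = k' := g'.he
    subst hek
    have hS2' : ∀ x, x ∈ S2 ↔ x = b ∨ x = c := by
      intro x
      have : x ∈ s(p, q) ↔ x ∈ s(b, c) := by rw [← hk, g'.hab]
      rw [hS2]
      simpa using this
    have huc : u = c := ((hS2' u).1 hu2).resolve_left hub
    subst huc
    constructor
    · intro h
      exfalso
      rw [show ({k} : Set G.E) = insert k ∅ by simp, Re_insert hD (by simp) g'.hab] at h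
      obtain ⟨x, hx, h⟩ := h
      have := Re_supp hD (S := ∅) (by simp) h (x := b) (by simp)
      simp only [Pi.sub_apply, Pi.smul_apply, smul_eq_mul, dl_self, dl_ne hub] at this
      exact hx (by linear_combination -this)
    · rintro ⟨x, hx, hxu, hxv, hev⟩
      exfalso
      by_cases hxa : x = a
      · subst hxa; rw [dA] at hev; revert hev; decide
      have hxb : x = b := ((hS2' x).1 (g'.mem (g.mem hx hxv) hxa)).resolve_right hxu
      subst hxb
      rw [dB, deg_single g'.hab] at hev
      simp at hev
      revert hev; decide
  have hmin' := g'.t.mindeg h3'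
  have huc : u ≠ c := by
    rintro rfl
    have := hmin' u hu2
    omega
  have hdu2 : G.degIn F2 u = 2 := by rw [← dO u huv hua hub huc, hdu]
  by_cases hc : G.degIn F2 c = 2
  · rw [IH S2.ncard (by omega) S2 F2 c rfl g'.t hu2 huc hdu2 hc]
    · constructor
      · rintro ⟨x, hx, hxu, hxc, hev⟩
        have hxv : x ≠ v := fun h => hv2 (h ▸ hx)
        have hxa : x ≠ a := fun h => g'.hv (h ▸ hx)
        refine ⟨x, sub2 x hx, hxu, hxv, ?_⟩
        by_cases hxb : x = b
        · subst hxb; rw [dB]; exact hev.add (by decide)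
        · rwa [dO x hxv hxa hxb hxc]
      · rintro ⟨x, hx, hxu, hxv, hev⟩
        have hxa : x ≠ a := by rintro rfl; rw [dA] at hev; revert hev; decide
        have hxc : x ≠ c := by rintro rfl; rw [dC, hc] at hev; revert hev; decide
        refine ⟨x, g'.mem (g.mem hx hxv) hxa, hxu, hxc, ?_⟩
        by_cases hxb : x = b
        · subst hxb; rw [dB] at hev; simpa [Nat.even_add] using hev
        · rwa [← dO x hxv hxa hxb hxc]
    · by_cases h4 : S2.ncard = 3
      · exact Or.inl h4
      right
      intro x hx hdx
      by_contra hcon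
      push Not at hcon
      by_cases hxb : x = b
      · subst hxb
        exact g'.t.nonadj (by omega) hdx hc g'.he g'.hab
      have hxv : x ≠ v := fun h => hv2 (h ▸ hx)
      have hxa : x ≠ a := fun h => g'.hv (h ▸ hx)
      have := hleaf x (sub2 x hx) (by rw [dO x hxv hxa hxb hcon.2, hdx])
      tauto
  · obtain ⟨y, hy, hdy, hyu⟩ := g'.t.leaf_ne h3' hu2
    have hyb : y = b := by
      by_contra hxb
      have hxv : y ≠ v := fun h => hv2 (h ▸ hy)
      have hxa : y ≠ a := fun h => g'.hv (h ▸ hy)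
      have hxc : y ≠ c := by rintro rfl; exact hc hdy
      have := hleaf y (sub2 y hy) (by rw [dO y hxv hxa hxb hxc, hdy])
      tauto
    subst hyb
    apply iff_of_true
    · obtain ⟨S3, F3, p, q, l, l1, l2, g''⟩ := g'.t.remove hdy
      have hu3 : u ∈ S3 := g''.mem hu2 hub
      have hc3 : c ∈ S3 := g''.mem g'.hb g'.ab.symm
      obtain ⟨z, hz⟩ := g''.t.free hD (dl u - dl c) (by
        intro x hx
        rw [Pi.sub_apply, dl_ne (a := u) (x := x) (fun h => hx (h ▸ hu3)),
          dl_ne (a := c) (x := x) (fun h => hx (h ▸ hc3)), sub_zero]) (by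
        simp only [Pi.sub_apply, Finset.sum_sub_distrib, sum_dl, sub_self]) l g''.he p q g''.hab
      obtain ⟨t, w, ht, hw, htw⟩ := z3sum z
      rw [g''.Re hD]
      refine ⟨-t, t, by simpa using ht, ht, ?_⟩
      rw [← Set.insert_sdiff_self_of_mem g''.he, Re_insert hD (by simp) g''.hab]
      refine ⟨w, hw, ?_⟩
      convert hz using 1
      rw [← htw]
      module
    · refine ⟨y, sub2 y hy, hyu, fun h => hv2 (h ▸ hy), ?_⟩
      rw [dB, hdy]; decide

end CrystalProof

open CrystalProof Multigraph
/-- A crystal has no nowhere-zero 3-flow iff every vertex has odd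
degree. -/
theorem stmt_4 (G : Multigraph) (hG : G.IsCrystal) :
    ¬ G.HasNZ3Flow ↔ ∀ v : G.V, Odd (G.degree v) := by
  obtain ⟨F, u, v, e0, ⟨hT, hP⟩, huv, hdu, hdv, he0, hends, huniv⟩ := hG
  have hT := of_triangleTree hT
  have hdeg : ∀ x, G.degree x = G.degIn F x + if x = u ∨ x = v then 1 else 0 := by
    intro x
    rw [← deg_insert he0 hends, huniv]
    simp [degree, degIn]
  have hleaf : (Set.univ : Set G.V).ncard = 3 ∨
      ∀ x ∈ (Set.univ : Set G.V), G.degIn F x = 2 → x = u ∨ x = v := by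
    refine hP.imp id fun h x _ hx => ?_
    have hsub : ({u, v} : Set G.V) ⊆ {v ∈ Set.univ | G.degIn F v = 2} := by
      rintro y (rfl | rfl)
      · exact ⟨trivial, hdu⟩
      · exact ⟨trivial, hdv⟩
    have := Set.eq_of_subset_of_ncard_le hsub (by rw [h, Set.ncard_pair huv]) (Set.toFinite _)
    have hx' : x ∈ ({u, v} : Set G.V) := by rw [this]; exact ⟨trivial, hx⟩
    simpa using hx'
  have key : ∀ D, G.IsOrientation D →
      (Re D Set.univ 0 ↔ ∃ x, x ≠ u ∧ x ≠ v ∧ Even (G.degIn F x)) := by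
    intro D hD
    have hm := main hD u _ Set.univ F v rfl hT trivial huv hdu hdv hleaf
    simp only [Set.mem_univ, true_and] at hm
    rw [← hm, ← huniv, Re_insert hD he0 hends]
    constructor
    · rintro ⟨x, hx, h⟩
      have : x = 1 ∨ x = -1 := by clear h; revert x; decide
      rcases this with rfl | rfl
      · convert Re_neg h using 1; module
      · convert h using 1; module
    · intro h
      refine ⟨-1, by decide, ?_⟩
      convert h using 1; module
  have hflow : G.HasNZ3Flow ↔ ∃ x, x ≠ u ∧ x ≠ v ∧ Even (G.degIn F x) := by
    constructor
    · rintro ⟨D, f, hD, h1, h2⟩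
      exact (key D hD).1 (Re_of_flow h1 h2)
    · intro h
      obtain ⟨D, hD⟩ := exists_orientation G
      exact flow_of_Re hD ((key D hD).2 h)
  rw [hflow]
  constructor
  · intro h x
    rw [hdeg]
    split_ifs with hx
    · rcases hx with rfl | rfl
      · rw [hdu]; decide
      · rw [hdv]; decide
    · push Not at h hx
      have := h x hx.1 hx.2
      simpa using this
  · rintro h ⟨x, hxu, hxv, hev⟩
    have := h x
    rw [hdeg, if_neg (by tauto)] at this
    exact (Nat.not_even_iff_odd.2 this) (by simpa using hev)
end
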